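/- arXiv:0909.4336 — 10 statements merged into one kernel-verified Lean document; each statement's English description precedes it below -/
import Mathlib

section
/- Let f : ℝ → ℝ be Lebesgue integrable and let g : ℝ → ℝ be of bounded variation. Then for every x ∈ ℝ the convolution f∗g(x) = ∫_ℝ f(x−y)g(y) dy exists, and for every x ∈ ℝ one has |f∗g(x)| ≤ |∫_ℝ f| · inf_{y∈ℝ} |g(y)| + ‖f‖_A · Vg; in particular sup_{x∈ℝ} |f∗g(x)| ≤ ‖f‖_A · (|g(−∞)| + Vg), where g(−∞) denotes the limit of g at −∞ (which exists since g has bounded variation). -/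
open MeasureTheory Filter

/-- The Alexiewicz norm of `f`: the supremum over real `α ≤ β` of `|∫_α^β f|`. -/
noncomputable def alexNorm (f : ℝ → ℝ) : ℝ :=
  ⨆ p : { p : ℝ × ℝ // p.1 ≤ p.2 }, |∫ x in p.val.1..p.val.2, f x|


lemma aux_ordConnected (h : ℝ → ℝ) (hh : Integrable h) (A : ℝ)
    (hA : ∀ a b : ℝ, a ≤ b → |∫ x in a..b, h x| ≤ A) (S : Set ℝ) (hS : S.OrdConnected) :
    |∫ x in S, h x| ≤ A := by
  have hA0 : 0 ≤ A := le_trans (abs_nonneg _) (hA 0 0 le_rfl)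
  have hIoc : ∀ a b : ℝ, |∫ x in Set.Ioc a b, h x| ≤ A := by
    intro a b
    rcases le_or_gt a b with hab | hab
    · rw [← intervalIntegral.integral_of_le hab]; exact hA a b hab
    · rw [Set.Ioc_eq_empty (not_lt.2 hab.le)]; simpa using hA0
  have hIoi : ∀ a : ℝ, |∫ x in Set.Ioi a, h x| ≤ A := by
    intro a
    refine le_of_tendsto
      (intervalIntegral_tendsto_integral_Ioi a hh.integrableOn tendsto_id).abs ?_
    filter_upwards [eventually_ge_atTop a] with b hb using hA a b hb
  have hIic : ∀ b : ℝ, |∫ x in Set.Iic b, h x| ≤ A := by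
    intro b
    refine le_of_tendsto
      (intervalIntegral_tendsto_integral_Iic b hh.integrableOn tendsto_id).abs ?_
    filter_upwards [eventually_le_atBot b] with a ha using hA a b ha
  have huniv : |∫ x, h x| ≤ A := by
    refine le_of_tendsto
      (intervalIntegral_tendsto_integral hh tendsto_neg_atTop_atBot tendsto_id).abs ?_
    filter_upwards [eventually_ge_atTop 0] with a ha
    exact hA _ _ (by simp only [id]; linarith)
  have key := hS.isPreconnected.mem_intervals
  simp only [Set.mem_insert_iff, Set.mem_singleton_iff] at key
  rcases key with h1 | h1 | h1 | h1 | h1 | h1 | h1 | h1 | h1 | h1 <;> rw [h1]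
  · rw [integral_Icc_eq_integral_Ioc]; exact hIoc _ _
  · rw [integral_Ico_eq_integral_Ioo, ← integral_Ioc_eq_integral_Ioo]; exact hIoc _ _
  · exact hIoc _ _
  · rw [← integral_Ioc_eq_integral_Ioo]; exact hIoc _ _
  · rw [integral_Ici_eq_integral_Ioi]; exact hIoi _
  · exact hIoi _
  · exact hIic _
  · rw [← integral_Iic_eq_integral_Iio]; exact hIic _
  · rw [setIntegral_univ]; exact huniv
  · simpa using hA0

lemma aux_layer (h : ℝ → ℝ) (hh : Integrable h) (A : ℝ) (k : ℝ → ℝ) (hk : Measurable k)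
    (b : ℝ) (hk0 : ∀ y, 0 ≤ k y) (hkb : ∀ y, k y ≤ b)
    (hA : ∀ s : ℝ, |∫ x in {y | s < k y}, h x| ≤ A) :
    |∫ y, h y * k y| ≤ A * b := by
  have hb : 0 ≤ b := (hk0 0).trans (hkb 0)
  have hms : MeasurableSet {z : ℝ × ℝ | z.2 < k z.1} :=
    measurableSet_lt measurable_snd (hk.comp measurable_fst)
  have e1 : ∀ y, h y * k y
      = ∫ s in Set.Ioc 0 b, Set.indicator {z : ℝ × ℝ | z.2 < k z.1} (fun z => h z.1) (y, s) := by
    intro y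
    have : ∀ s, Set.indicator {z : ℝ × ℝ | z.2 < k z.1} (fun z => h z.1) (y, s)
        = Set.indicator (Set.Iio (k y)) (fun _ => h y) s := by
      intro s; simp [Set.indicator]
    simp only [this]
    rw [setIntegral_indicator measurableSet_Iio]
    have hset : Set.Ioc 0 b ∩ Set.Iio (k y) = Set.Ioo 0 (k y) := by
      ext s; simp only [Set.mem_inter_iff, Set.mem_Ioc, Set.mem_Iio, Set.mem_Ioo]
      have := hkb y
      constructor
      · rintro ⟨⟨h1, h2⟩, h3⟩; exact ⟨h1, h3⟩
      · rintro ⟨h1, h3⟩; exact ⟨⟨h1, by linarith⟩, h3⟩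
    rw [hset]
    simp [hk0 y, mul_comm]
  have hint : Integrable (Function.uncurry fun y s : ℝ =>
      Set.indicator {z : ℝ × ℝ | z.2 < k z.1} (fun z => h z.1) (y, s))
      (volume.prod (volume.restrict (Set.Ioc 0 b))) := by
    have : Integrable (fun z : ℝ × ℝ => h z.1) (volume.prod (volume.restrict (Set.Ioc 0 b))) :=
      hh.comp_fst _
    exact this.indicator hms
  simp only [e1]
  rw [integral_integral_swap hint]
  have := norm_setIntegral_le_of_norm_le_const (μ := volume) (s := Set.Ioc 0 b) (C := A)
    (f := fun s => ∫ y, Set.indicator {z : ℝ × ℝ | z.2 < k z.1} (fun z => h z.1) (y, s))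
    (by simp) (by
      intro s _
      have e : ∀ y, Set.indicator {z : ℝ × ℝ | z.2 < k z.1} (fun z => h z.1) (y, s)
        = Set.indicator {y | s < k y} h y := by
        intro y; simp [Set.indicator]
      simp only [e]
      rw [integral_indicator (measurableSet_lt measurable_const hk)]
      exact hA s)
  simpa [hb] using this

lemma aux_mono (h : ℝ → ℝ) (hh : Integrable h) (A : ℝ)
    (hA : ∀ a b : ℝ, a ≤ b → |∫ x in a..b, h x| ≤ A)
    (p : ℝ → ℝ) (hp : Monotone p) (m M c : ℝ) (hm : ∀ y, m ≤ p y) (hM : ∀ y, p y ≤ M) :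
    Integrable (fun y => h y * (p y - p c)) ∧ |∫ y, h y * (p y - p c)| ≤ A * (M - m) := by
  have hb1 : ∀ y, max (p y - p c) 0 ≤ M - p c := fun y =>
    max_le (by linarith [hM y]) (by linarith [hM c])
  have hb2 : ∀ y, max (p c - p y) 0 ≤ p c - m := fun y =>
    max_le (by linarith [hm y]) (by linarith [hm c])
  have hm1 : Measurable fun y => max (p y - p c) 0 :=
    (hp.measurable.sub measurable_const).max measurable_const
  have hm2 : Measurable fun y => max (p c - p y) 0 :=
    (measurable_const.sub hp.measurable).max measurable_const
  have i1 : Integrable (fun y => h y * max (p y - p c) 0) :=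
    hh.mul_bdd (c := M - p c) hm1.aestronglyMeasurable (Eventually.of_forall fun y => by
      rw [Real.norm_of_nonneg (le_max_right _ _)]; exact hb1 y)
  have i2 : Integrable (fun y => h y * max (p c - p y) 0) :=
    hh.mul_bdd (c := p c - m) hm2.aestronglyMeasurable (Eventually.of_forall fun y => by
      rw [Real.norm_of_nonneg (le_max_right _ _)]; exact hb2 y)
  have e : (fun y => h y * (p y - p c))
      = fun y => h y * max (p y - p c) 0 - h y * max (p c - p y) 0 := by
    funext y
    rcases le_total (p y) (p c) with h1 | h1
    · rw [max_eq_right (by linarith), max_eq_left (by linarith)]; ring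
    · rw [max_eq_left (by linarith), max_eq_right (by linarith)]; ring
  have b1 : |∫ y, h y * max (p y - p c) 0| ≤ A * (M - p c) := by
    refine aux_layer h hh A _ hm1 _ (fun y => le_max_right _ _) hb1 fun s => ?_
    refine aux_ordConnected h hh A hA _ ⟨?_⟩
    intro x hx y hy z hz
    rw [Set.mem_setOf_eq] at hx ⊢
    refine lt_of_lt_of_le hx (max_le_max_right _ ?_)
    linarith [hp hz.1]
  have b2 : |∫ y, h y * max (p c - p y) 0| ≤ A * (p c - m) := by
    refine aux_layer h hh A _ hm2 _ (fun y => le_max_right _ _) hb2 fun s => ?_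
    refine aux_ordConnected h hh A hA _ ⟨?_⟩
    intro x hx y hy z hz
    rw [Set.mem_setOf_eq] at hy ⊢
    refine lt_of_lt_of_le hy (max_le_max_right _ ?_)
    linarith [hp hz.2]
  rw [e]
  refine ⟨i1.sub i2, ?_⟩
  rw [integral_sub i1 i2]
  refine (abs_sub _ _).trans ?_
  linarith

lemma aux_main (h g : ℝ → ℝ) (hh : Integrable h) (A : ℝ)
    (hA : ∀ a b : ℝ, a ≤ b → |∫ x in a..b, h x| ≤ A)
    (hg : BoundedVariationOn g Set.univ) (c : ℝ) :
    Integrable (fun y => h y * g y) ∧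
    |∫ y, h y * g y| ≤ |∫ y, h y| * |g c| + A * (eVariationOn g Set.univ).toReal := by
  have hA0 : 0 ≤ A := le_trans (abs_nonneg _) (hA 0 0 le_rfl)
  obtain ⟨p, q, hp, hq, hgpq, hV⟩ := hg.locallyBoundedVariationOn.exists_monotoneOn_sub_monotoneOn'
  rw [monotoneOn_univ] at hp hq
  set V := (eVariationOn g Set.univ).toReal with hVdef
  have hVle : ∀ x y, (p y - p x) + (q y - q x) ≤ V := fun x y => by
    rw [hV x trivial y trivial]
    exact (le_abs_self _).trans (variationOnFromTo.abs_le_eVariationOn hg)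
  have hV0 : 0 ≤ V := ENNReal.toReal_nonneg
  have hpV : ∀ x y, p y - p x ≤ V := fun x y => by
    rcases le_total x y with hxy | hxy
    · linarith [hVle x y, hq hxy]
    · linarith [hp hxy]
  have hqV : ∀ x y, q y - q x ≤ V := fun x y => by
    rcases le_total x y with hxy | hxy
    · linarith [hVle x y, hp hxy]
    · linarith [hq hxy]
  have bp : BddAbove (Set.range p) := ⟨p 0 + V, by rintro _ ⟨y, rfl⟩; linarith [hpV 0 y]⟩
  have bq : BddAbove (Set.range q) := ⟨q 0 + V, by rintro _ ⟨y, rfl⟩; linarith [hqV 0 y]⟩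
  have bp' : BddBelow (Set.range p) := ⟨p 0 - V, by rintro _ ⟨y, rfl⟩; linarith [hpV y 0]⟩
  have bq' : BddBelow (Set.range q) := ⟨q 0 - V, by rintro _ ⟨y, rfl⟩; linarith [hqV y 0]⟩
  have hsum : ((⨆ y, p y) - ⨅ y, p y) + ((⨆ y, q y) - ⨅ y, q y) ≤ V := by
    have t1 : ∀ x, ((⨆ y, p y) - p x) + ((⨆ y, q y) - q x) ≤ V := fun x =>
      le_of_tendsto' (((tendsto_atTop_ciSup hp bp).sub_const (p x)).add
        ((tendsto_atTop_ciSup hq bq).sub_const (q x))) (hVle x)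
    exact le_of_tendsto' (((tendsto_atBot_ciInf hp bp').const_sub _).add
        ((tendsto_atBot_ciInf hq bq').const_sub _)) t1
  obtain ⟨ip, hpb⟩ := aux_mono h hh A hA p hp _ _ c (ciInf_le bp') (le_ciSup bp)
  obtain ⟨iq, hqb⟩ := aux_mono h hh A hA q hq _ _ c (ciInf_le bq') (le_ciSup bq)
  have e : (fun y => h y * g y)
      = fun y => h y * g c + (h y * (p y - p c) - h y * (q y - q c)) := by
    funext y; rw [hgpq]; simp only [Pi.sub_apply]; ring
  have ic : Integrable (fun y => h y * g c) := hh.mul_const _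
  have ipq : Integrable (fun y => h y * (p y - p c) - h y * (q y - q c)) := ip.sub iq
  rw [e]
  refine ⟨ic.add ipq, ?_⟩
  rw [integral_add ic ipq, integral_sub ip iq, integral_mul_const]
  refine (abs_add_le _ _).trans ?_
  rw [abs_mul]
  have h1 := abs_sub (∫ y, h y * (p y - p c)) (∫ y, h y * (q y - q c))
  have h2 := mul_le_mul_of_nonneg_left hsum hA0
  linarith

/-- If `f` is Lebesgue integrable and `g` has bounded variation on `ℝ` (with limit `gm`
at `-∞`), then the convolution `f ∗ g (x) = ∫ f(x-y) g(y) dy` exists for every `x`, and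
satisfies `|f∗g(x)| ≤ |∫ f| ⬝ inf |g| + ‖f‖_A ⬝ Vg ≤ ‖f‖_A (|g(-∞)| + Vg)`. -/
theorem convolution_exists_and_uniform_bound
    (f g : ℝ → ℝ) (hf : Integrable f)
    (hg : BoundedVariationOn g Set.univ)
    (gm : ℝ) (hgm : Tendsto g atBot (nhds gm)) :
    (∀ x : ℝ, Integrable (fun y => f (x - y) * g y)) ∧
    (∀ x : ℝ, |∫ y, f (x - y) * g y| ≤
        |∫ y, f y| * (⨅ y : ℝ, |g y|) +
          alexNorm f * (eVariationOn g Set.univ).toReal) ∧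
    (∀ x : ℝ, |∫ y, f (x - y) * g y| ≤
        alexNorm f * (|gm| + (eVariationOn g Set.univ).toReal)) := by
  have hbdd : BddAbove (Set.range fun p : { p : ℝ × ℝ // p.1 ≤ p.2 } =>
      |∫ x in p.val.1..p.val.2, f x|) := by
    refine ⟨∫ x, ‖f x‖, ?_⟩
    rintro _ ⟨⟨⟨a, b⟩, hab⟩, rfl⟩
    simp only at hab ⊢
    rw [intervalIntegral.integral_of_le hab]
    exact (norm_integral_le_integral_norm _).trans
      (setIntegral_le_integral hf.norm (Eventually.of_forall fun _ => norm_nonneg _))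
  have hAf : ∀ a b : ℝ, a ≤ b → |∫ x in a..b, f x| ≤ alexNorm f := fun a b hab =>
    le_ciSup hbdd ⟨(a, b), hab⟩
  have hA0 : 0 ≤ alexNorm f := le_trans (abs_nonneg _) (hAf 0 0 le_rfl)
  have key : ∀ x c : ℝ, Integrable (fun y => f (x - y) * g y) ∧
      |∫ y, f (x - y) * g y| ≤
        |∫ y, f y| * |g c| + alexNorm f * (eVariationOn g Set.univ).toReal := by
    intro x c
    have := aux_main (fun y => f (x - y)) g (hf.comp_sub_left x) (alexNorm f) (by
      intro a b hab
      rw [intervalIntegral.integral_comp_sub_left]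
      exact hAf _ _ (by linarith)) hg c
    rwa [integral_sub_left_eq_self f volume x] at this
  refine ⟨fun x => (key x 0).1, fun x => ?_, fun x => ?_⟩
  · rw [Real.mul_iInf_of_nonneg (abs_nonneg _), ← sub_le_iff_le_add]
    exact le_ciInf fun c => by linarith [(key x c).2]
  · have h1 : |∫ y, f y| ≤ alexNorm f := by
      have := aux_ordConnected f hf _ hAf Set.univ Set.ordConnected_univ
      rwa [setIntegral_univ] at this
    have h2 : |∫ y, f (x - y) * g y| ≤
        |∫ y, f y| * |gm| + alexNorm f * (eVariationOn g Set.univ).toReal :=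
      ge_of_tendsto' ((hgm.abs.const_mul _).add_const _) fun c => (key x c).2
    have h3 := mul_le_mul_of_nonneg_right h1 (abs_nonneg gm)
    linarith
end

section
/- Let F : ℝ → ℝ be continuous with F(x) → 0 as x → −∞ and F(x) → L ∈ ℝ as x → +∞, and let μ be a finite signed Borel measure on ℝ. Define Φ(x) = ∫_ℝ F(x−y) dμ(y). Then Φ is uniformly continuous on ℝ, Φ(x) → L·μ(ℝ) as x → +∞, and Φ(x) → 0 as x → −∞. -/
open MeasureTheory Filter

/-- Integration of a real function against a finite signed Borel measure, defined as
the difference of the integrals against the positive and negative parts of the Jordan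
decomposition. -/
noncomputable def signedIntegral (μ : MeasureTheory.SignedMeasure ℝ) (f : ℝ → ℝ) : ℝ :=
  (∫ y, f y ∂μ.toJordanDecomposition.posPart) - ∫ y, f y ∂μ.toJordanDecomposition.negPart

lemma aux_decomp (G : ℝ → ℝ) (hG : Continuous G) (b : ℝ)
    (hm : Tendsto G atBot (nhds 0)) (hp : Tendsto G atTop (nhds b)) :
    Tendsto (fun x => G x - b * max 0 (min 1 x)) (cocompact ℝ) (nhds 0) := by
  rw [cocompact_eq_atBot_atTop, tendsto_sup]
  constructor
  · refine hm.congr' ?_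
    filter_upwards [eventually_le_atBot (0 : ℝ)] with x hx
    rw [min_eq_right (by linarith), max_eq_left hx]; ring
  · have h := hp.sub_const b
    rw [sub_self] at h
    refine h.congr' ?_
    filter_upwards [eventually_ge_atTop (1 : ℝ)] with x hx
    rw [min_eq_left hx, max_eq_right zero_le_one]; ring

lemma aux_uc (G : ℝ → ℝ) (hG : Continuous G) (b : ℝ)
    (hm : Tendsto G atBot (nhds 0)) (hp : Tendsto G atTop (nhds b)) :
    UniformContinuous G := by
  have h1 : UniformContinuous (fun x => G x - b * max 0 (min 1 x)) :=
    Continuous.uniformContinuous_of_tendsto_cocompact (by fun_prop) (aux_decomp G hG b hm hp)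
  have h2 : UniformContinuous (fun x : ℝ => max 0 (min 1 x)) :=
    ((LipschitzWith.id.const_min 1).const_max 0).uniformContinuous
  have h3 := h1.add (h2.const_mul' b)
  simpa using h3

lemma aux_bdd (G : ℝ → ℝ) (hG : Continuous G) (b : ℝ)
    (hm : Tendsto G atBot (nhds 0)) (hp : Tendsto G atTop (nhds b)) :
    ∃ C, ∀ x, ‖G x‖ ≤ C := by
  let f : ZeroAtInftyContinuousMap ℝ ℝ :=
    ⟨⟨fun x => G x - b * max 0 (min 1 x), by fun_prop⟩, aux_decomp G hG b hm hp⟩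
  refine ⟨‖f.toBCF‖ + |b|, fun x => ?_⟩
  have h1 : ‖G x - b * max 0 (min 1 x)‖ ≤ ‖f.toBCF‖ := f.toBCF.norm_coe_le_norm x
  have h2 : ‖b * max 0 (min 1 x)‖ ≤ |b| := by
    rw [norm_mul, Real.norm_eq_abs, Real.norm_eq_abs]
    refine mul_le_of_le_one_right (abs_nonneg b) ?_
    rw [abs_of_nonneg (le_max_left _ _)]
    exact max_le zero_le_one (min_le_left _ _)
  calc ‖G x‖ = ‖(G x - b * max 0 (min 1 x)) + b * max 0 (min 1 x)‖ := by congr 1; ring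
    _ ≤ _ := (norm_add_le _ _).trans (add_le_add h1 h2)

lemma aux_meas (F : ℝ → ℝ) (hF : Continuous F) (L : ℝ)
    (hFm : Tendsto F atBot (nhds 0)) (hFp : Tendsto F atTop (nhds L))
    (ν : Measure ℝ) [IsFiniteMeasure ν] :
    Continuous (fun x => ∫ y, F (x - y) ∂ν) ∧
    Tendsto (fun x => ∫ y, F (x - y) ∂ν) atTop (nhds (L * ν.real Set.univ)) ∧
    Tendsto (fun x => ∫ y, F (x - y) ∂ν) atBot (nhds 0) := by
  obtain ⟨C, hC⟩ := aux_bdd F hF L hFm hFp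
  have hmeas : ∀ x, AEStronglyMeasurable (fun y => F (x - y)) ν := fun x =>
    (show Continuous (fun y => F (x - y)) by fun_prop).aestronglyMeasurable
  refine ⟨?_, ?_, ?_⟩
  · exact continuous_of_dominated (bound := fun _ => C) hmeas
      (fun x => ae_of_all _ fun y => hC _) (integrable_const C)
      (ae_of_all _ fun y => by fun_prop)
  · have h := tendsto_integral_filter_of_dominated_convergence (μ := ν) (l := atTop)
      (F := fun x y => F (x - y)) (f := fun _ => L) (fun _ => C)
      (Eventually.of_forall hmeas) (Eventually.of_forall fun x => ae_of_all _ fun y => hC _)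
      (integrable_const C)
      (ae_of_all _ fun y => hFp.comp (tendsto_atTop_add_const_right atTop (-y) tendsto_id))
    simpa [mul_comm] using h
  · have h := tendsto_integral_filter_of_dominated_convergence (μ := ν) (l := atBot)
      (F := fun x y => F (x - y)) (f := fun _ => (0 : ℝ)) (fun _ => C)
      (Eventually.of_forall hmeas) (Eventually.of_forall fun x => ae_of_all _ fun y => hC _)
      (integrable_const C)
      (ae_of_all _ fun y => hFm.comp (tendsto_atBot_add_const_right atBot (-y) tendsto_id))
    simpa using h

/-- Let `F : ℝ → ℝ` be continuous with limit `0` at `-∞` and limit `L` at `+∞`, and let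
`μ` be a finite signed Borel measure on `ℝ`.  Then `Φ(x) = ∫ F(x-y) dμ(y)` is uniformly
continuous, tends to `L ⬝ μ(ℝ)` at `+∞` and to `0` at `-∞`. -/
theorem signed_convolution_uniformly_continuous_and_limits
    (F : ℝ → ℝ) (hF : Continuous F) (L : ℝ)
    (hFm : Tendsto F atBot (nhds 0)) (hFp : Tendsto F atTop (nhds L))
    (μ : MeasureTheory.SignedMeasure ℝ) :
    UniformContinuous (fun x => signedIntegral μ (fun y => F (x - y))) ∧
    Tendsto (fun x => signedIntegral μ (fun y => F (x - y))) atTop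
      (nhds (L * μ Set.univ)) ∧
    Tendsto (fun x => signedIntegral μ (fun y => F (x - y))) atBot (nhds 0) := by
  obtain ⟨c1, t1, b1⟩ := aux_meas F hF L hFm hFp μ.toJordanDecomposition.posPart
  obtain ⟨c2, t2, b2⟩ := aux_meas F hF L hFm hFp μ.toJordanDecomposition.negPart
  have hμ : μ Set.univ = μ.toJordanDecomposition.posPart.real Set.univ
      - μ.toJordanDecomposition.negPart.real Set.univ := by
    conv_lhs => rw [← μ.toSignedMeasure_toJordanDecomposition]
    rw [JordanDecomposition.toSignedMeasure, Measure.toSignedMeasure_sub_apply MeasurableSet.univ]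
  have t : Tendsto (fun x => signedIntegral μ (fun y => F (x - y))) atTop
      (nhds (L * μ Set.univ)) := by
    rw [hμ, mul_sub]; exact t1.sub t2
  have b : Tendsto (fun x => signedIntegral μ (fun y => F (x - y))) atBot (nhds 0) := by
    rw [← sub_zero (0 : ℝ)]; exact b1.sub b2
  exact ⟨aux_uc _ (c1.sub c2) _ b t, t, b⟩
end

section
/- Let μ be a finite signed Borel measure on ℝ and set g(y) = μ((−∞, y]); assume g is Lebesgue integrable on ℝ. Let F : ℝ → ℝ be bounded and continuous. Then for all real α ≤ β, ∫_α^β ( ∫_ℝ F(x−y) dμ(y) ) dx = ∫_ℝ ( F(β−y) − F(α−y) ) g(y) dy. -/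
open MeasureTheory Filter

lemma aux_swap (P : Measure ℝ) [IsFiniteMeasure P] (k : ℝ → ℝ) (C : ℝ) (hC : ∀ x, |k x| ≤ C)
    (hk : Continuous k) (a b : ℝ) (hab : a ≤ b) :
    ∫ y in a..b, (∫ t in y..b, k t) ∂P = ∫ t in a..b, k t * (P.real (Set.Iic t) - P.real (Set.Iic a)) := by
  have hS : MeasurableSet {p : ℝ × ℝ | p.1 ≤ p.2} := measurableSet_le measurable_fst measurable_snd
  have hint : Integrable (Function.uncurry fun y t : ℝ => {p : ℝ × ℝ | p.1 ≤ p.2}.indicator (fun p => k p.2) (y, t))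
      ((P.restrict (Set.Ioc a b)).prod (volume.restrict (Set.Ioc a b))) := by
    refine Integrable.of_bound (C := C) ?_ (Eventually.of_forall ?_)
    · refine Measurable.aestronglyMeasurable ?_
      exact (hk.measurable.comp measurable_snd).indicator hS
    · rintro ⟨y, t⟩
      simp only [Function.uncurry_apply_pair]
      exact (norm_indicator_le_norm_self _ _).trans (hC t)
  have h := integral_integral_swap hint
  rw [intervalIntegral.integral_of_le hab, intervalIntegral.integral_of_le hab]
  convert h using 1
  · refine setIntegral_congr_fun measurableSet_Ioc fun y hy => ?_
    rw [intervalIntegral.integral_of_le hy.2]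
    have : ∀ t, {p : ℝ × ℝ | p.1 ≤ p.2}.indicator (fun p => k p.2) (y, t) = (Set.Ici y).indicator k t := by
      intro t; simp [Set.indicator]
    simp_rw [this]
    rw [setIntegral_indicator measurableSet_Ici, ← integral_Icc_eq_integral_Ioc]
    congr 2
    ext t
    simp only [Set.mem_Icc, Set.mem_inter_iff, Set.mem_Ioc, Set.mem_Ici]
    constructor
    · rintro ⟨h1, h2⟩; exact ⟨⟨hy.1.trans_le h1, h2⟩, h1⟩
    · rintro ⟨⟨h1, h2⟩, h3⟩; exact ⟨h3, h2⟩
  · refine setIntegral_congr_fun measurableSet_Ioc fun t ht => ?_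
    have : ∀ y, {p : ℝ × ℝ | p.1 ≤ p.2}.indicator (fun p => k p.2) (y, t)
        = (Set.Iic t).indicator (fun _ => k t) y := by
      intro y; simp [Set.indicator]
    simp_rw [this]
    rw [setIntegral_indicator measurableSet_Iic, setIntegral_const, smul_eq_mul, mul_comm]
    congr 1
    have e : Set.Ioc a b ∩ Set.Iic t = Set.Iic t \ Set.Iic a := by
      ext y
      simp only [Set.mem_inter_iff, Set.mem_Ioc, Set.mem_Iic, Set.mem_sdiff, not_le]
      constructor
      · rintro ⟨⟨h1, h2⟩, h3⟩; exact ⟨h3, h1⟩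
      · rintro ⟨h1, h2⟩; exact ⟨⟨h2, h1.trans ht.2⟩, h1⟩
    rw [e, measureReal_sdiff (Set.Iic_subset_Iic.2 ht.1.le) measurableSet_Iic]

lemma aux_mono_s4 (P : Measure ℝ) [IsFiniteMeasure P] : Monotone fun t => P.real (Set.Iic t) :=
  fun _ _ h => measureReal_mono (Set.Iic_subset_Iic.2 h)

lemma aux_parts (P : Measure ℝ) [IsFiniteMeasure P] (h k : ℝ → ℝ) (C : ℝ) (hC : ∀ x, |k x| ≤ C)
    (hk : Continuous k) (hh : ∀ x, HasDerivAt h (- k x) x) (a b : ℝ) (hab : a ≤ b) :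
    ∫ y in a..b, h y ∂P = h b * P.real (Set.Iic b) - h a * P.real (Set.Iic a)
      + ∫ t in a..b, k t * P.real (Set.Iic t) := by
  have hI : ∀ y z, ∫ t in y..z, k t = h y - h z := by
    intro y z
    have := intervalIntegral.integral_eq_sub_of_hasDerivAt (a := y) (b := z) (fun x _ => (hh x).neg)
      (by simpa using hk.intervalIntegrable y z)
    simp only [neg_neg, Pi.neg_apply] at this
    rw [this]; ring
  have hhc : Continuous h := continuous_iff_continuousAt.2 fun x => (hh x).continuousAt
  have h1 := aux_swap P k C hC hk a b hab
  simp_rw [hI, mul_sub] at h1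
  have hkP : IntervalIntegrable (fun t => k t * P.real (Set.Iic t)) volume a b :=
    (aux_mono_s4 P).intervalIntegrable.continuousOn_mul hk.continuousOn
  rw [intervalIntegral.integral_sub (hhc.intervalIntegrable _ _) (by simp),
    intervalIntegral.integral_sub hkP ((hk.intervalIntegrable _ _).mul_const _),
    intervalIntegral.integral_mul_const, hI] at h1
  have h2 : ∫ _ in a..b, h b ∂P = (P.real (Set.Iic b) - P.real (Set.Iic a)) * h b := by
    rw [intervalIntegral.integral_of_le hab, setIntegral_const, smul_eq_mul,
      show Set.Ioc a b = Set.Iic b \ Set.Iic a by ext x; simp [and_comm],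
      measureReal_sdiff (Set.Iic_subset_Iic.2 hab) measurableSet_Iic]
  rw [h2] at h1
  linarith

/-- Let `μ` be a finite signed Borel measure on `ℝ`, let `g(y) = μ((-∞, y])` be Lebesgue
integrable, and let `F` be bounded and continuous.  Then for all `α ≤ β`,
`∫_α^β (∫ F(x-y) dμ(y)) dx = ∫ (F(β-y) - F(α-y)) g(y) dy`. -/
theorem interval_integral_signed_convolution
    (μ : MeasureTheory.SignedMeasure ℝ)
    (g : ℝ → ℝ) (hg : ∀ y, g y = μ (Set.Iic y)) (hgint : Integrable g)
    (F : ℝ → ℝ) (hFb : ∃ C : ℝ, ∀ x, |F x| ≤ C) (hFc : Continuous F) :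
    ∀ α β : ℝ, α ≤ β →
      ∫ x in α..β, signedIntegral μ (fun y => F (x - y)) =
        ∫ y, (F (β - y) - F (α - y)) * g y := by
  intro α β hαβ
  obtain ⟨C, hC⟩ := hFb
  unfold signedIntegral
  have hg' : ∀ y, g y = μ.toJordanDecomposition.posPart.real (Set.Iic y)
      - μ.toJordanDecomposition.negPart.real (Set.Iic y) := by
    intro y
    rw [hg y]
    conv_lhs => rw [← μ.toSignedMeasure_toJordanDecomposition]
    rw [JordanDecomposition.toSignedMeasure, Measure.toSignedMeasure_sub_apply measurableSet_Iic]
  have hPf : IsFiniteMeasure μ.toJordanDecomposition.posPart := inferInstance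
  have hNf : IsFiniteMeasure μ.toJordanDecomposition.negPart := inferInstance
  generalize μ.toJordanDecomposition.posPart = P at *
  generalize μ.toJordanDecomposition.negPart = N at *
  set h : ℝ → ℝ := fun y => ∫ x in α..β, F (x - y) with hh
  set k : ℝ → ℝ := fun y => F (β - y) - F (α - y) with hkdef
  have hk : Continuous k := by fun_prop
  have hkC : ∀ x, |k x| ≤ C + C := fun x => (abs_sub _ _).trans (add_le_add (hC _) (hC _))
  have hhC : ∀ y, |h y| ≤ C * |β - α| := by
    intro y
    rw [hh, ← Real.norm_eq_abs]
    exact intervalIntegral.norm_integral_le_of_norm_le_const fun x _ => hC _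
  have hd : ∀ y, HasDerivAt h (- k y) y := by
    have e : h = fun y => (∫ x in (0:ℝ)..(β - y), F x) - ∫ x in (0:ℝ)..(α - y), F x := by
      funext y
      rw [hh]
      simp only
      rw [intervalIntegral.integral_comp_sub_right,
        intervalIntegral.integral_interval_sub_left (hFc.intervalIntegrable _ _)
          (hFc.intervalIntegrable _ _)]
    intro y
    have D : ∀ c : ℝ, HasDerivAt (fun y => ∫ x in (0:ℝ)..(c - y), F x) (F (c - y) * (-1)) y := by
      intro c
      have h1 : HasDerivAt (fun u => ∫ x in (0:ℝ)..u, F x) (F (c - y)) (c - y) :=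
        (hFc.integral_hasStrictDerivAt 0 (c - y)).hasDerivAt
      exact h1.comp y ((hasDerivAt_id y).const_sub c)
    rw [e]
    have e2 : - k y = F (β - y) * (-1) - F (α - y) * (-1) := by
      change -(F (β - y) - F (α - y)) = _
      ring
    rw [e2]
    exact (D β).sub (D α)
  have hhc : Continuous h := continuous_iff_continuousAt.2 fun x => (hd x).continuousAt
  have hprod : ∀ (Q : Measure ℝ) [IsFiniteMeasure Q], Integrable (Function.uncurry fun x y => F (x - y))
      ((volume.restrict (Set.uIoc α β)).prod Q) := by
    intro Q _
    rw [Set.uIoc_of_le hαβ]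
    refine Integrable.of_bound (C := C) ?_ (Eventually.of_forall fun p => hC _)
    exact Continuous.aestronglyMeasurable (by unfold Function.uncurry; fun_prop)
  have hII : ∀ (Q : Measure ℝ) [IsFiniteMeasure Q],
      IntervalIntegrable (fun x => ∫ y, F (x - y) ∂Q) volume α β := by
    intro Q _
    rw [intervalIntegrable_iff]
    exact (hprod Q).integral_prod_left
  have hhint : ∀ (Q : Measure ℝ) [IsFiniteMeasure Q], Integrable h Q := fun Q _ =>
    Integrable.of_bound hhc.aestronglyMeasurable _ (Eventually.of_forall hhC)
  rw [intervalIntegral.integral_sub (hII P) (hII N), intervalIntegral_integral_swap (hprod P),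
    intervalIntegral_integral_swap (hprod N)]
  change (∫ y, h y ∂P) - ∫ y, h y ∂N = ∫ y, k y * g y
  have hgfun : g = fun y => P.real (Set.Iic y) - N.real (Set.Iic y) := funext hg'
  have bdA : ∀ (Q : Measure ℝ) [IsFiniteMeasure Q], BddAbove (Set.range fun t => Q.real (Set.Iic t)) :=
    fun Q _ => ⟨Q.real Set.univ, by rintro _ ⟨t, rfl⟩; exact measureReal_mono (Set.subset_univ _)⟩
  have bdB : ∀ (Q : Measure ℝ) [IsFiniteMeasure Q], BddBelow (Set.range fun t => Q.real (Set.Iic t)) :=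
    fun Q _ => ⟨0, by rintro _ ⟨t, rfl⟩; exact measureReal_nonneg⟩
  have gtop : Tendsto g atTop (nhds 0) := by
    obtain ⟨L, A⟩ : ∃ L, Tendsto g atTop (nhds L) := by
      rw [hgfun]
      exact ⟨_, (tendsto_atTop_ciSup (aux_mono_s4 P) (bdA P)).sub (tendsto_atTop_ciSup (aux_mono_s4 N) (bdA N))⟩
    have B := IntegrableAtFilter.eq_zero_of_tendsto (hgint.integrableAtFilter atTop) (by
      intro s hs
      rcases mem_atTop_sets.1 hs with ⟨b, hb⟩
      rw [← top_le_iff, ← Real.volume_Ici (a := b)]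
      exact measure_mono hb) A
    rwa [B] at A
  have gbot : Tendsto g atBot (nhds 0) := by
    obtain ⟨L, A⟩ : ∃ L, Tendsto g atBot (nhds L) := by
      rw [hgfun]
      exact ⟨_, (tendsto_atBot_ciInf (aux_mono_s4 P) (bdB P)).sub (tendsto_atBot_ciInf (aux_mono_s4 N) (bdB N))⟩
    have B := IntegrableAtFilter.eq_zero_of_tendsto (hgint.integrableAtFilter atBot) (by
      intro s hs
      rcases mem_atBot_sets.1 hs with ⟨b, hb⟩
      rw [← top_le_iff, ← Real.volume_Iic (a := b)]
      exact measure_mono hb) A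
    rwa [B] at A
  have hz : ∀ l : Filter ℝ, Tendsto g l (nhds 0) → Tendsto (fun y => h y * g y) l (nhds 0) := by
    intro l hl
    refine squeeze_zero_norm (a := fun y => C * |β - α| * |g y|) (fun y => ?_) ?_
    · rw [norm_mul]
      exact mul_le_mul_of_nonneg_right (hhC y) (abs_nonneg _)
    · simpa using (hl.abs).const_mul (C * |β - α|)
  have hkg : Integrable fun y => k y * g y :=
    hgint.bdd_mul hk.aestronglyMeasurable (Eventually.of_forall hkC)
  have tl : Tendsto (fun T : ℝ => (∫ y in (-T)..T, h y ∂P) - ∫ y in (-T)..T, h y ∂N) atTop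
      (nhds ((∫ y, h y ∂P) - ∫ y, h y ∂N)) :=
    (intervalIntegral_tendsto_integral (hhint P) tendsto_neg_atTop_atBot tendsto_id).sub
      (intervalIntegral_tendsto_integral (hhint N) tendsto_neg_atTop_atBot tendsto_id)
  have tr : Tendsto (fun T : ℝ => h T * g T - h (-T) * g (-T) + ∫ y in (-T)..T, k y * g y) atTop
      (nhds (0 - 0 + ∫ y, k y * g y)) :=
    ((hz _ gtop).sub ((hz _ gbot).comp tendsto_neg_atTop_atBot)).add
      (intervalIntegral_tendsto_integral hkg tendsto_neg_atTop_atBot tendsto_id)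
  rw [sub_zero, zero_add] at tr
  refine tendsto_nhds_unique (tl.congr' ?_) tr
  filter_upwards [eventually_ge_atTop 0] with T hT
  have hT' : -T ≤ T := by linarith
  have hkQ : ∀ (Q : Measure ℝ) [IsFiniteMeasure Q],
      IntervalIntegrable (fun t => k t * Q.real (Set.Iic t)) volume (-T) T :=
    fun Q _ => (aux_mono_s4 Q).intervalIntegrable.continuousOn_mul hk.continuousOn
  rw [aux_parts P h k _ hkC hk hd _ _ hT', aux_parts N h k _ hkC hk hd _ _ hT']
  simp_rw [hg', mul_sub]
  rw [intervalIntegral.integral_sub (hkQ P) (hkQ N)]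
  ring
end

section
/- Let μ be a finite signed Borel measure on ℝ and set g(y) = μ((−∞, y]); assume g is Lebesgue integrable on ℝ with ‖g‖₁ = ∫_ℝ |g|. Let F : ℝ → ℝ be bounded and continuous. Then sup over real α ≤ β of | ∫_α^β ( ∫_ℝ F(x−y) dμ(y) ) dx | ≤ ( sup over real a ≤ b of |F(b) − F(a)| ) · ‖g‖₁. -/
open MeasureTheory Filter

theorem aux_clamp (Φ D : ℝ → ℝ) (hD : ∀ t, HasDerivAt Φ (D t) t) (hDc : Continuous D)
    (r : ℝ) (hr : 0 ≤ r) (y : ℝ) :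
    Φ (max (-r) (min y r)) = Φ r - ∫ t in Set.Ioc (-r) r, (Set.Ici y).indicator D t := by
  have hle : max (-r) (min y r) ≤ r := max_le (by linarith) (min_le_right _ _)
  have h1 := intervalIntegral.integral_eq_sub_of_hasDerivAt (a := max (-r) (min y r)) (b := r)
    (fun t _ => hD t) (hDc.intervalIntegrable _ _)
  rw [setIntegral_indicator measurableSet_Ici]
  have h2 : (Set.Ioc (-r) r ∩ Set.Ici y : Set ℝ) =ᵐ[volume] Set.Ioc (max (-r) (min y r)) r := by
    have h3 : (Set.Ioc (max (-r) (min y r)) r : Set ℝ) = Set.Ioc (-r) r ∩ Set.Ioi y := by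
      ext t
      simp only [Set.mem_Ioc, Set.mem_inter_iff, Set.mem_Ioi, max_lt_iff, min_lt_iff]
      constructor
      · rintro ⟨⟨a, b⟩, c⟩
        exact ⟨⟨a, c⟩, b.resolve_right (not_lt.mpr c)⟩
      · rintro ⟨⟨a, c⟩, b⟩
        exact ⟨⟨a, Or.inl b⟩, c⟩
    rw [h3]
    exact (ae_eq_refl _).inter Ioi_ae_eq_Ici.symm
  rw [setIntegral_congr_set h2, ← intervalIntegral.integral_of_le hle, h1]
  ring

theorem aux_parts_s5 (ν : Measure ℝ) [IsFiniteMeasure ν] (Φ D : ℝ → ℝ)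
    (hD : ∀ t, HasDerivAt Φ (D t) t) (hDc : Continuous D) (C : ℝ) (hC : ∀ t, |D t| ≤ C)
    (r : ℝ) (hr : 0 ≤ r) :
    ∫ y, Φ (max (-r) (min y r)) ∂ν
      = Φ r * ν.real Set.univ - ∫ t in Set.Ioc (-r) r, D t * ν.real (Set.Iic t) := by
  have hC0 : 0 ≤ C := (abs_nonneg _).trans (hC 0)
  have hint : Integrable (Function.uncurry fun y t => (Set.Ici y).indicator D t)
      (ν.prod (volume.restrict (Set.Ioc (-r) r))) := by
    apply Integrable.of_bound (C := C)
    · have : (Function.uncurry fun y t => (Set.Ici y).indicator D t)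
          = Set.indicator {p : ℝ × ℝ | p.1 ≤ p.2} (fun p => D p.2) := by
        ext p
        simp [Function.uncurry, Set.indicator]
      rw [this]
      exact ((hDc.measurable.comp measurable_snd).indicator
        (measurableSet_le measurable_fst measurable_snd)).aestronglyMeasurable
    · refine Eventually.of_forall fun p => ?_
      simp only [Function.uncurry, Set.indicator]
      split_ifs
      · exact hC _
      · simpa using hC0
  simp_rw [aux_clamp Φ D hD hDc r hr]
  have hint2 : Integrable (fun y => ∫ t in Set.Ioc (-r) r, (Set.Ici y).indicator D t) ν :=
    hint.integral_prod_left
  rw [integral_sub (integrable_const _) hint2, integral_integral_swap hint]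
  congr 1
  · simp [mul_comm]
  · congr 1
    ext t
    have : (fun y => (Set.Ici y).indicator D t) = (Set.Iic t).indicator (fun _ => D t) := by
      ext y
      simp [Set.indicator]
    rw [this, integral_indicator measurableSet_Iic]
    simp [mul_comm]

theorem aux_lim (ν : Measure ℝ) [IsFiniteMeasure ν] (Φ : ℝ → ℝ) (hΦ : Continuous Φ)
    (K : ℝ) (hK : ∀ y, |Φ y| ≤ K) :
    Tendsto (fun n : ℕ => ∫ y, Φ (max (-(n:ℝ)) (min y n)) ∂ν) atTop (nhds (∫ y, Φ y ∂ν)) := by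
  apply tendsto_integral_of_dominated_convergence (fun _ => K)
  · intro n
    exact Continuous.aestronglyMeasurable (by fun_prop)
  · exact integrable_const _
  · intro n
    exact Eventually.of_forall fun y => hK _
  · refine Eventually.of_forall fun y => tendsto_const_nhds.congr' ?_
    obtain ⟨m, hm⟩ := exists_nat_ge |y|
    filter_upwards [eventually_ge_atTop m] with n hn
    have h : |y| ≤ n := hm.trans (by exact_mod_cast hn)
    rw [abs_le] at h
    rw [min_eq_left h.2, max_eq_right h.1]

theorem aux_fubini (ν : Measure ℝ) [IsFiniteMeasure ν] (F : ℝ → ℝ) (C : ℝ)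
    (hC : ∀ x, |F x| ≤ C) (hF : Continuous F) (a b : ℝ) (hab : a ≤ b) :
    IntervalIntegrable (fun x => ∫ y, F (x - y) ∂ν) volume a b ∧
    ∫ x in a..b, (∫ y, F (x - y) ∂ν) = ∫ y, (∫ x in a..b, F (x - y)) ∂ν := by
  have hint : Integrable (Function.uncurry fun x y => F (x - y))
      ((volume.restrict (Set.Ioc a b)).prod ν) := by
    apply Integrable.of_bound (C := C)
    · exact Continuous.aestronglyMeasurable (by unfold Function.uncurry; fun_prop)
    · exact Eventually.of_forall fun p => hC _
  constructor
  · rw [intervalIntegrable_iff_integrableOn_Ioc_of_le hab]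
    exact hint.integral_prod_left
  · simp_rw [intervalIntegral.integral_of_le hab]
    exact integral_integral_swap hint

theorem aux_signed (μ : SignedMeasure ℝ) (s : Set ℝ) (hs : MeasurableSet s) :
    μ s = μ.toJordanDecomposition.posPart.real s - μ.toJordanDecomposition.negPart.real s := by
  conv_lhs => rw [← μ.toSignedMeasure_toJordanDecomposition]
  simp [JordanDecomposition.toSignedMeasure, Measure.toSignedMeasure_apply_measurable hs]

theorem aux_cdf (ν : Measure ℝ) [IsFiniteMeasure ν] :
    Tendsto (fun t => ν.real (Set.Iic t)) atTop (nhds (ν.real Set.univ)) :=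
  (ENNReal.tendsto_toReal (measure_ne_top _ _)).comp (tendsto_measure_Iic_atTop ν)

theorem aux_zero (g : ℝ → ℝ) (hg : Integrable g) (c : ℝ) (h : Tendsto g atTop (nhds c)) :
    c = 0 := by
  by_contra hc
  have hpos : 0 < |c| / 2 := by positivity
  have h2 : ∀ᶠ t in atTop, |c| / 2 < |g t| :=
    h.abs.eventually_const_lt (by linarith [abs_pos.mpr hc])
  obtain ⟨T, hT⟩ := eventually_atTop.mp h2
  have h3 : volume {x | |c| / 2 ≤ ‖g x‖} < ⊤ := hg.measure_norm_ge_lt_top hpos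
  have h4 : volume (Set.Ici T) ≤ volume {x | |c| / 2 ≤ ‖g x‖} :=
    measure_mono fun t ht => (hT t ht).le
  rw [Real.volume_Ici] at h4
  exact absurd (h4.trans_lt h3) (lt_irrefl _)

/-- Let `μ` be a finite signed Borel measure on `ℝ`, let `g(y) = μ((-∞, y])` be Lebesgue
integrable, and let `F` be bounded and continuous.  Then
`sup_{α ≤ β} |∫_α^β (∫ F(x-y) dμ(y)) dx| ≤ (sup_{a ≤ b} |F(b) - F(a)|) ⬝ ‖g‖₁`. -/
theorem alexiewicz_bound_signed_convolution
    (μ : MeasureTheory.SignedMeasure ℝ)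
    (g : ℝ → ℝ) (hg : ∀ y, g y = μ (Set.Iic y)) (hgint : Integrable g)
    (F : ℝ → ℝ) (hFb : ∃ C : ℝ, ∀ x, |F x| ≤ C) (hFc : Continuous F) :
    (⨆ p : { p : ℝ × ℝ // p.1 ≤ p.2 },
        |∫ x in p.val.1..p.val.2, signedIntegral μ (fun y => F (x - y))|) ≤
      (⨆ p : { p : ℝ × ℝ // p.1 ≤ p.2 }, |F p.val.2 - F p.val.1|) * ∫ y, |g y| := by
  obtain ⟨C, hC⟩ := hFb
  set M := ⨆ p : { p : ℝ × ℝ // p.1 ≤ p.2 }, |F p.val.2 - F p.val.1| with hMdef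
  have hbdd : BddAbove (Set.range fun p : { p : ℝ × ℝ // p.1 ≤ p.2 } =>
      |F p.val.2 - F p.val.1|) := by
    refine ⟨C + C, ?_⟩
    rintro _ ⟨p, rfl⟩
    exact (abs_sub _ _).trans (add_le_add (hC _) (hC _))
  have hM : ∀ a b, a ≤ b → |F b - F a| ≤ M := fun a b hab =>
    le_ciSup hbdd (⟨(a, b), hab⟩ : { p : ℝ × ℝ // p.1 ≤ p.2 })
  have : Nonempty { p : ℝ × ℝ // p.1 ≤ p.2 } := ⟨⟨(0, 0), le_refl _⟩⟩
  refine ciSup_le ?_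
  rintro ⟨⟨a, b⟩, hab⟩
  simp only at hab ⊢
  set P := μ.toJordanDecomposition.posPart with hP
  set N := μ.toJordanDecomposition.negPart with hN
  have hgPN : ∀ t, g t = P.real (Set.Iic t) - N.real (Set.Iic t) := fun t => by
    rw [hg, aux_signed μ _ measurableSet_Iic]
  have huniv : P.real Set.univ - N.real Set.univ = 0 := by
    apply aux_zero g hgint
    rw [funext hgPN]
    exact (aux_cdf P).sub (aux_cdf N)
  obtain ⟨iP, eP⟩ := aux_fubini P F C hC hFc a b hab
  obtain ⟨iN, eN⟩ := aux_fubini N F C hC hFc a b hab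
  set Φ : ℝ → ℝ := fun y => ∫ x in a..b, F (x - y) with hΦ
  set D : ℝ → ℝ := fun t => F (a - t) - F (b - t) with hDdef
  have hDc : Continuous D := by fun_prop
  have hD : ∀ t, HasDerivAt Φ (D t) t := by
    intro t
    have e : Φ = fun y => (∫ x in (0:ℝ)..(b - y), F x) - ∫ x in (0:ℝ)..(a - y), F x := by
      ext y
      rw [hΦ]
      simp only
      rw [intervalIntegral.integral_comp_sub_right (fun x => F x),
        intervalIntegral.integral_interval_sub_left (hFc.intervalIntegrable _ _)
          (hFc.intervalIntegrable _ _)]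
    have k : ∀ c, HasDerivAt (fun y => ∫ x in (0:ℝ)..(c - y), F x) (F (c - t) * (-1)) t := by
      intro c
      have h1 := (hFc.integral_hasStrictDerivAt 0 (c - t)).hasDerivAt
      have h2 : HasDerivAt (fun y : ℝ => c - y) (-1) t := by
        simpa using (hasDerivAt_id t).const_sub c
      exact HasDerivAt.comp t h1 h2
    rw [e]
    have e4 : D t = F (b - t) * (-1) - F (a - t) * (-1) := by
      change F (a - t) - F (b - t) = _
      ring
    rw [e4]
    exact (k b).sub (k a)
  have hDM : ∀ t, |D t| ≤ M := by
    intro t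
    change |F (a - t) - F (b - t)| ≤ M
    rw [abs_sub_comm]
    exact hM _ _ (by linarith)
  have hΦc : Continuous Φ := continuous_iff_continuousAt.mpr fun t => (hD t).continuousAt
  have hΦb : ∀ y, |Φ y| ≤ C * |b - a| := fun y => by
    have h := intervalIntegral.norm_integral_le_of_norm_le_const (a := a) (b := b)
      (f := fun x => F (x - y)) (C := C) (fun x _ => hC _)
    exact h
  have key : (∫ x in a..b, signedIntegral μ (fun y => F (x - y)))
      = (∫ y, Φ y ∂P) - ∫ y, Φ y ∂N := by
    unfold signedIntegral
    rw [intervalIntegral.integral_sub iP iN, eP, eN]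
  rw [key]
  have lim := ((aux_lim P Φ hΦc _ hΦb).sub (aux_lim N Φ hΦc _ hΦb)).abs
  refine le_of_tendsto lim (Eventually.of_forall fun n => ?_)
  have hn : (0:ℝ) ≤ n := Nat.cast_nonneg n
  rw [aux_parts_s5 P Φ D hD hDc M hDM n hn, aux_parts_s5 N Φ D hD hDc M hDM n hn]
  have hI : ∀ (ν : Measure ℝ) [IsFiniteMeasure ν],
      IntegrableOn (fun t => D t * ν.real (Set.Iic t)) (Set.Ioc (-(n:ℝ)) n) := by
    intro ν _
    have hmono : Monotone fun t => ν.real (Set.Iic t) := fun s t hst =>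
      measureReal_mono (Set.Iic_subset_Iic.mpr hst)
    apply Integrable.of_bound (C := M * ν.real Set.univ)
    · exact (hDc.measurable.mul hmono.measurable).aestronglyMeasurable
    · refine Eventually.of_forall fun t => ?_
      rw [norm_mul]
      refine mul_le_mul (hDM t) ?_ (norm_nonneg _) ((abs_nonneg _).trans (hDM t))
      rw [Real.norm_of_nonneg measureReal_nonneg]
      exact measureReal_mono (Set.subset_univ _)
  have e2 : (∫ t in Set.Ioc (-(n:ℝ)) n, D t * P.real (Set.Iic t))
      - (∫ t in Set.Ioc (-(n:ℝ)) n, D t * N.real (Set.Iic t))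
      = ∫ t in Set.Ioc (-(n:ℝ)) n, D t * g t := by
    rw [← integral_sub (hI P) (hI N)]
    congr 1
    ext t
    rw [hgPN]
    ring
  have e3 : Φ n * P.real Set.univ - (∫ t in Set.Ioc (-(n:ℝ)) n, D t * P.real (Set.Iic t))
      - (Φ n * N.real Set.univ - ∫ t in Set.Ioc (-(n:ℝ)) n, D t * N.real (Set.Iic t))
      = - ∫ t in Set.Ioc (-(n:ℝ)) n, D t * g t := by
    rw [← e2]
    linear_combination Φ n * huniv
  rw [e3, abs_neg, ← integral_const_mul]
  have hMg : Integrable (fun t => M * |g t|) := hgint.abs.const_mul M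
  calc |∫ t in Set.Ioc (-(n:ℝ)) n, D t * g t|
      ≤ ∫ t in Set.Ioc (-(n:ℝ)) n, M * |g t| := by
        rw [← Real.norm_eq_abs]
        refine norm_integral_le_of_norm_le hMg.integrableOn (Eventually.of_forall fun t => ?_)
        rw [norm_mul]
        exact mul_le_mul_of_nonneg_right (hDM t) (abs_nonneg _)
    _ ≤ ∫ t, M * |g t| :=
        setIntegral_le_integral hMg (Eventually.of_forall fun t =>
          mul_nonneg ((abs_nonneg _).trans (hDM 0)) (abs_nonneg _))
end

section
/- Let f, g : ℝ → ℝ be Lebesgue integrable. Then the convolution f∗g satisfies ‖f∗g‖_A ≤ ‖f‖_A · ‖g‖₁, where ‖g‖₁ = ∫_ℝ |g|. -/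
open MeasureTheory Filter

theorem abs_le_alexNorm (f : ℝ → ℝ) (hf : Integrable f) (a b : ℝ) (hab : a ≤ b) :
    |∫ x in a..b, f x| ≤ alexNorm f := by
  have hb : BddAbove (Set.range fun p : { p : ℝ × ℝ // p.1 ≤ p.2 } =>
      |∫ x in p.val.1..p.val.2, f x|) := by
    refine ⟨∫ x, |f x|, ?_⟩
    rintro _ ⟨p, rfl⟩
    have h1 := intervalIntegral.abs_integral_le_integral_abs (f := f) (μ := volume) p.2
    refine h1.trans ?_
    rw [intervalIntegral.integral_of_le p.2]
    exact setIntegral_le_integral hf.abs (Eventually.of_forall fun x => abs_nonneg _)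
  exact le_ciSup hb ⟨(a, b), hab⟩

/-- For `f, g` Lebesgue integrable, `‖f ∗ g‖_A ≤ ‖f‖_A ⬝ ‖g‖₁`. -/
theorem alexNorm_convolution_le
    (f g : ℝ → ℝ) (hf : Integrable f) (hg : Integrable g) :
    alexNorm (fun x => ∫ y, f (x - y) * g y) ≤ alexNorm f * ∫ y, |g y| := by
  have hne : Nonempty { p : ℝ × ℝ // p.1 ≤ p.2 } := ⟨⟨(0, 0), le_rfl⟩⟩
  refine ciSup_le ?_
  rintro ⟨⟨a, b⟩, hab⟩
  simp only at hab ⊢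
  have hint : Integrable (Function.uncurry fun x y : ℝ => f (x - y) * g y)
      (volume.prod volume) := by
    have h := hg.convolution_integrand (ContinuousLinearMap.mul ℝ ℝ) hf
    refine h.congr (Eventually.of_forall fun p => ?_)
    simp [Function.uncurry, mul_comm]
  have hint' : Integrable (Function.uncurry fun x y : ℝ => f (x - y) * g y)
      ((volume.restrict (Set.uIoc a b)).prod volume) :=
    hint.mono_measure (Measure.prod_mono Measure.restrict_le_self le_rfl)
  rw [intervalIntegral_integral_swap hint', ← integral_const_mul, ← Real.norm_eq_abs]
  refine norm_integral_le_of_norm_le (hg.abs.const_mul _) (Eventually.of_forall fun y => ?_)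
  rw [intervalIntegral.integral_mul_const, intervalIntegral.integral_comp_sub_right,
    Real.norm_eq_abs, abs_mul]
  exact mul_le_mul_of_nonneg_right (abs_le_alexNorm f hf _ _ (by linarith)) (abs_nonneg _)
end

section
/- Let f, g : ℝ → ℝ be Lebesgue integrable, let a = ∫_ℝ g, and for t > 0 define g_t(x) = g(x/t)/t. Then ‖f∗g_t − a·f‖_A → 0 as t → 0⁺. -/
open MeasureTheory Filter

theorem aux_small (f : ℝ → ℝ) (hf : Integrable f) (ε : ℝ) (hε : 0 < ε) :
    ∃ δ > 0, ∀ u v : ℝ, |v - u| < δ → |∫ x in u..v, f x| ≤ ε := by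
  obtain ⟨δ, hδ, h⟩ := exists_pos_setLIntegral_lt_of_measure_lt (μ := volume)
    (f := fun x => ‖f x‖ₑ) hf.hasFiniteIntegral.ne (ε := ENNReal.ofReal ε)
    (by simpa using hε)
  obtain ⟨d, hd0, hd⟩ := exists_between hδ
  have hdt : d ≠ ⊤ := (hd.trans_le le_top).ne
  refine ⟨d.toReal, ENNReal.toReal_pos hd0.ne' hdt, fun u v huv => ?_⟩
  have h1 := h (Set.uIoc u v) (by
    rw [Real.volume_uIoc]
    exact ((ENNReal.ofReal_lt_iff_lt_toReal (abs_nonneg _) hdt).2 huv).trans hd)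
  have h2 : |∫ x in u..v, f x| = ‖∫ x in Set.uIoc u v, f x‖ := by
    rw [← Real.norm_eq_abs, intervalIntegral.norm_intervalIntegral_eq]
  rw [h2]
  have h3 : ‖∫ x in Set.uIoc u v, f x‖ₑ ≤ ENNReal.ofReal ε :=
    (enorm_integral_le_lintegral_enorm _).trans h1.le
  rw [← ofReal_norm_eq_enorm] at h3
  exact (ENNReal.ofReal_le_ofReal_iff hε.le).1 h3

theorem aux_bound (f : ℝ → ℝ) (hf : Integrable f) (u v : ℝ) :
    |∫ x in u..v, f x| ≤ ∫ x, ‖f x‖ := by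
  rw [← Real.norm_eq_abs]
  refine intervalIntegral.norm_integral_le_integral_norm_uIoc.trans ?_
  exact setIntegral_le_integral hf.norm (Eventually.of_forall fun x => norm_nonneg _)

theorem aux_diff (f : ℝ → ℝ) (hf : Integrable f) (ε δ : ℝ) (hε : 0 < ε) (hδ : 0 < δ)
    (h : ∀ u v : ℝ, |v - u| < δ → |∫ x in u..v, f x| ≤ ε) (α β s : ℝ) :
    |(∫ x in α..β, f (x - s)) - ∫ x in α..β, f x| ≤
      2 * (ε + (∫ x, ‖f x‖) * min 1 (|s| / δ)) := by
  have hM : 0 ≤ ∫ x, ‖f x‖ := integral_nonneg fun x => norm_nonneg _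
  have key : ∀ u, |∫ x in (u - s)..u, f x| ≤ ε + (∫ x, ‖f x‖) * min 1 (|s| / δ) := by
    intro u
    by_cases hs : |s| < δ
    · have := h (u - s) u (by simpa using hs)
      have : 0 ≤ (∫ x, ‖f x‖) * min 1 (|s| / δ) := by positivity
      linarith
    · have h1 : 1 ≤ |s| / δ := by rw [le_div_iff₀ hδ]; linarith
      rw [min_eq_left h1]
      have := aux_bound f hf (u - s) u
      linarith
  rw [intervalIntegral.integral_comp_sub_right,
    intervalIntegral.integral_interval_sub_interval_comm hf.intervalIntegrable
      hf.intervalIntegrable hf.intervalIntegrable]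
  have := abs_sub (∫ x in (α - s)..α, f x) (∫ x in (β - s)..β, f x)
  linarith [key α, key β]

theorem aux_fubini_s7 (f g : ℝ → ℝ) (hf : Integrable f) (hg : Integrable g) (t : ℝ) (ht : 0 < t)
    (α β : ℝ) :
    ∫ x in α..β, ((∫ y, f (x - y) * (g (y / t) / t)) - (∫ y, g y) * f x) =
      ∫ y, g y * ((∫ x in α..β, f (x - t * y)) - ∫ x in α..β, f x) := by
  have hG : Integrable (fun y => g (y / t) / t) := (hg.comp_div ht.ne').div_const t
  have hI : Integrable (fun p : ℝ × ℝ => f (p.1 - p.2) * (g (p.2 / t) / t))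
      (volume.prod volume) := by
    have := hG.convolution_integrand (ContinuousLinearMap.mul ℝ ℝ) hf
    simpa [mul_comm] using! this
  have hIr : Integrable (fun p : ℝ × ℝ => f (p.1 - p.2) * (g (p.2 / t) / t))
      ((volume.restrict (Set.uIoc α β)).prod volume) :=
    hI.mono_measure (Measure.prod_mono Measure.restrict_le_self le_rfl)
  have h1 : Integrable (fun x => ∫ y, f (x - y) * (g (y / t) / t)) := hI.integral_prod_left
  rw [intervalIntegral.integral_sub h1.intervalIntegrable
    (hf.const_mul _).intervalIntegrable, intervalIntegral_integral_swap hIr,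
    intervalIntegral.integral_const_mul]
  have h2 : Integrable (fun y => ∫ x in α..β, f (x - y) * (g (y / t) / t)) := by
    have := hIr.integral_prod_right
    rcases le_total α β with h | h
    · simpa [intervalIntegral.integral_of_le h, Set.uIoc_of_le h] using this
    · simpa [intervalIntegral.integral_of_ge h, Set.uIoc_of_ge h] using this.neg
  have h3 : ∫ y, (∫ x in α..β, f (x - y) * (g (y / t) / t)) =
      ∫ y, g y * ∫ x in α..β, f (x - t * y) := by
    have := Measure.integral_comp_div (fun y => g y * ∫ x in α..β, f (x - t * y)) t
    rw [abs_of_pos ht, smul_eq_mul] at this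
    rw [← mul_right_inj' ht.ne', ← this, ← integral_const_mul]
    congr 1; ext y
    rw [intervalIntegral.integral_mul_const, mul_div_cancel₀ _ ht.ne']
    field_simp
  have h4 : Integrable (fun y => g y * ∫ x in α..β, f (x - t * y)) := by
    have := (h2.comp_mul_left' ht.ne').const_mul t
    refine this.congr (Eventually.of_forall fun y => ?_)
    simp only [intervalIntegral.integral_mul_const, mul_div_cancel_left₀ _ ht.ne']
    field_simp
  rw [h3, ← integral_mul_const, ← integral_sub h4 (hg.mul_const _)]
  congr 1; ext y; ring

/-- Approximate identity in the Alexiewicz norm: for `f, g` Lebesgue integrable,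
`a = ∫ g` and `g_t(x) = g(x/t)/t`, one has `‖f ∗ g_t - a f‖_A → 0` as `t → 0⁺`. -/
theorem alexNorm_approximate_identity
    (f g : ℝ → ℝ) (hf : Integrable f) (hg : Integrable g) (a : ℝ) (ha : a = ∫ y, g y) :
    Tendsto (fun t : ℝ =>
        alexNorm (fun x => (∫ y, f (x - y) * (g (y / t) / t)) - a * f x))
      (nhdsWithin 0 (Set.Ioi 0)) (nhds 0) := by
  subst ha
  set M := ∫ x, ‖f x‖ with hM
  have hM0 : 0 ≤ M := integral_nonneg fun x => norm_nonneg _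
  set N := ∫ x, ‖g x‖ with hN
  have hN0 : 0 ≤ N := integral_nonneg fun x => norm_nonneg _
  have hnn : ∀ h : ℝ → ℝ, 0 ≤ alexNorm h := fun h => Real.iSup_nonneg fun p => abs_nonneg _
  rw [Metric.tendsto_nhds]
  intro η hη
  set ε := η / (4 * (N + 1)) with hε
  have hε0 : 0 < ε := by positivity
  obtain ⟨δ, hδ, hsm⟩ := aux_small f hf ε hε0
  set K : ℝ → ℝ → ℝ := fun t y => ‖g y‖ * (2 * (ε + M * min 1 (|t * y| / δ))) with hK
  have hKm : ∀ t, AEStronglyMeasurable (K t) volume := fun t =>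
    hg.norm.aestronglyMeasurable.mul (Continuous.aestronglyMeasurable (by fun_prop))
  have hKb : ∀ t y, ‖K t y‖ ≤ ‖g y‖ * (2 * (ε + M)) := by
    intro t y
    have h0 : 0 ≤ min 1 (|t * y| / δ) := by positivity
    have h1 : min 1 (|t * y| / δ) ≤ 1 := min_le_left _ _
    rw [Real.norm_of_nonneg (by positivity)]
    have : M * min 1 (|t * y| / δ) ≤ M := by nlinarith
    simp only [hK]
    gcongr
  have hbi : Integrable (fun y => ‖g y‖ * (2 * (ε + M))) := hg.norm.mul_const _
  have hKi : ∀ t, Integrable (K t) := fun t =>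
    hbi.mono' (hKm t) (Eventually.of_forall (hKb t))
  have hc : Continuous fun t => ∫ y, K t y :=
    continuous_of_dominated hKm (fun t => Eventually.of_forall (hKb t)) hbi
      (Eventually.of_forall fun y => by simp only [hK]; fun_prop)
  have hK0 : ∫ y, K 0 y < η := by
    have : ∫ y, K 0 y = N * (2 * ε) := by
      simp [hK, hN, integral_mul_const]
    rw [this, hε]
    have : N * (2 * (η / (4 * (N + 1)))) = (η / 2) * (N / (N + 1)) := by field_simp; ring
    rw [this]
    have : N / (N + 1) ≤ 1 := by rw [div_le_one (by positivity)]; linarith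
    nlinarith
  have hev : ∀ᶠ t in nhdsWithin (0 : ℝ) (Set.Ioi 0), ∫ y, K t y < η :=
    nhdsWithin_le_nhds (hc.continuousAt.eventually_lt continuousAt_const hK0)
  filter_upwards [hev, self_mem_nhdsWithin] with t ht ht0
  rw [Real.dist_eq, sub_zero, abs_of_nonneg (hnn _)]
  refine lt_of_le_of_lt ?_ ht
  haveI : Nonempty { p : ℝ × ℝ // p.1 ≤ p.2 } := ⟨⟨(0, 0), le_rfl⟩⟩
  refine ciSup_le fun p => ?_
  rw [aux_fubini_s7 f g hf hg t ht0, ← Real.norm_eq_abs]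
  refine norm_integral_le_of_norm_le (hKi t) (Eventually.of_forall fun y => ?_)
  rw [norm_mul]
  exact mul_le_mul_of_nonneg_left (aux_diff f hf ε δ hε0 hδ hsm _ _ _) (norm_nonneg _)
end

section
/- For every continuous F : ℝ → ℝ with F(x) → 0 as x → −∞ and F(x) → L ∈ ℝ as x → +∞, and for every ε > 0, there exists a Lebesgue integrable function h : ℝ → ℝ such that sup_{x∈ℝ} |F(x) − ∫_{−∞}^x h(t) dt| < ε. (That is, L¹ is dense in the space A_C of integrable distributions under the Alexiewicz norm.) -/
open MeasureTheory Filter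

/-- `L¹` is dense in `A_C` in the Alexiewicz norm: for every continuous `F : ℝ → ℝ` with
limit `0` at `-∞` and finite limit `L` at `+∞`, and every `ε > 0`, there is a Lebesgue
integrable `h` whose primitive is uniformly within `ε` of `F`. -/
theorem L1_dense_in_AC
    (F : ℝ → ℝ) (hF : Continuous F) (L : ℝ)
    (hFm : Tendsto F atBot (nhds 0)) (hFp : Tendsto F atTop (nhds L)) :
    ∀ ε > (0 : ℝ), ∃ h : ℝ → ℝ, Integrable h ∧
      ∀ x : ℝ, |F x - ∫ t in Set.Iic x, h t| < ε := by
  intro ε hε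
  have hd : 0 < ε / 5 := by positivity
  obtain ⟨a, ha⟩ := eventually_atBot.1 (Metric.tendsto_nhds.1 hFm (ε / 5) hd)
  obtain ⟨b₀, hb₀⟩ := eventually_atTop.1 (Metric.tendsto_nhds.1 hFp (ε / 5) hd)
  obtain ⟨b, hab, hb⟩ : ∃ b, a ≤ b ∧ ∀ x ≥ b, dist (F x) L < ε / 5 :=
    ⟨max a b₀, le_max_left _ _, fun x hx => hb₀ x ((le_max_right _ _).trans hx)⟩
  simp only [Real.dist_eq, sub_zero] at ha hb
  obtain ⟨p, hp⟩ := exists_polynomial_near_of_continuousOn a b F hF.continuousOn (ε / 5) hd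
  have hc : Continuous fun t => p.derivative.eval t := p.derivative.continuous
  have hint : ∀ y, a ≤ y → ∫ t in Set.Ioc a y, p.derivative.eval t = p.eval y - p.eval a := by
    intro y hy
    rw [← intervalIntegral.integral_of_le hy]
    exact intervalIntegral.integral_eq_sub_of_hasDerivAt (fun t _ => p.hasDerivAt t)
      (hc.intervalIntegrable _ _)
  refine ⟨(Set.Ioc a b).indicator fun t => p.derivative.eval t, ?_, fun x => ?_⟩
  · rw [integrable_indicator_iff measurableSet_Ioc]
    exact hc.integrableOn_Ioc
  rw [setIntegral_indicator measurableSet_Ioc]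
  have h1 := abs_lt.1 (hp a ⟨le_rfl, hab⟩)
  have h2 := abs_lt.1 (ha a le_rfl)
  rcases le_total x a with hx | hx
  · have : Set.Iic x ∩ Set.Ioc a b = ∅ := by
      ext t
      simp only [Set.mem_inter_iff, Set.mem_Iic, Set.mem_Ioc, Set.mem_empty_iff_false]
      grind
    rw [this]
    have := ha x hx
    simp
    linarith
  have hs : Set.Iic x ∩ Set.Ioc a b = Set.Ioc a (min b x) := by
    ext t
    simp only [Set.mem_inter_iff, Set.mem_Iic, Set.mem_Ioc, le_min_iff]
    tauto
  rw [hs, hint _ (le_min hab hx), abs_lt]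
  rcases le_total x b with hxb | hxb
  · rw [min_eq_right hxb]
    have h3 := abs_lt.1 (hp x ⟨hx, hxb⟩)
    constructor <;> linarith
  · rw [min_eq_left hxb]
    have h3 := abs_lt.1 (hp b ⟨hab, le_rfl⟩)
    have h4 := abs_lt.1 (hb x hxb)
    have h5 := abs_lt.1 (hb b le_rfl)
    constructor <;> linarith
end

section
/- Let f : ℝ → ℝ be Lebesgue integrable and let g : ℝ → ℝ be of bounded variation. Then |∫_ℝ f(x)g(x) dx| ≤ |∫_ℝ f| · inf_{x∈ℝ} |g(x)| + ‖f‖_A · Vg; in particular |∫_ℝ fg| ≤ ‖f‖_A · (|g(−∞)| + Vg), where g(−∞) is the limit of g at −∞. -/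
open MeasureTheory Filter

lemma alex_le (f : ℝ → ℝ) (hf : Integrable f) {a b : ℝ} (h : a ≤ b) :
    |∫ x in a..b, f x| ≤ alexNorm f := by
  have hb : BddAbove (Set.range (fun p : { p : ℝ × ℝ // p.1 ≤ p.2 } =>
      |∫ x in p.val.1..p.val.2, f x|)) := by
    refine ⟨∫ x, ‖f x‖, ?_⟩
    rintro _ ⟨⟨⟨p, q⟩, hpq⟩, rfl⟩
    simp only
    rw [intervalIntegral.integral_of_le hpq]
    calc _ ≤ ∫ x in Set.Ioc p q, ‖f x‖ := norm_integral_le_integral_norm _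
      _ ≤ _ := setIntegral_le_integral hf.norm (Eventually.of_forall fun x => norm_nonneg _)
  exact le_ciSup hb ⟨(a, b), h⟩

lemma alex_Ioi (f : ℝ → ℝ) (hf : Integrable f) (a : ℝ) :
    |∫ x in Set.Ioi a, f x| ≤ alexNorm f := by
  have h := (intervalIntegral_tendsto_integral_Ioi a hf.integrableOn tendsto_id).abs
  refine le_of_tendsto h ?_
  filter_upwards [eventually_ge_atTop a] with b hb using alex_le f hf hb

lemma alex_Iic (f : ℝ → ℝ) (hf : Integrable f) (a : ℝ) :
    |∫ x in Set.Iic a, f x| ≤ alexNorm f := by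
  have h := (intervalIntegral_tendsto_integral_Iic a hf.integrableOn tendsto_id).abs
  refine le_of_tendsto h ?_
  filter_upwards [eventually_le_atBot a] with b hb using alex_le f hf hb

lemma alex_univ (f : ℝ → ℝ) (hf : Integrable f) :
    |∫ x, f x| ≤ alexNorm f := by
  have h := (intervalIntegral_tendsto_integral hf tendsto_neg_atTop_atBot
    (tendsto_id (α := ℝ) (x := atTop))).abs
  refine le_of_tendsto h ?_
  filter_upwards [eventually_ge_atTop 0] with b hb
  exact alex_le f hf (by simp only [id]; linarith)

lemma alex_sum_le (g : ℝ → ℝ) (hg : BoundedVariationOn g Set.univ) (u : ℕ → ℝ)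
    (hu : Monotone u) (N : ℕ) :
    ∑ k ∈ Finset.range N, |g (u (k+1)) - g (u k)| ≤ (eVariationOn g Set.univ).toReal := by
  have h := eVariationOn.sum_le (f := g) (s := Set.univ) (n := N) hu (fun _ => Set.mem_univ _)
  have h2 := ENNReal.toReal_mono hg h
  rw [ENNReal.toReal_sum (fun _ _ => edist_ne_top _ _)] at h2
  simpa [edist_dist, Real.dist_eq] using h2

/-- step approximation -/
noncomputable def alexStep (g : ℝ → ℝ) (u : ℕ → ℝ) (N : ℕ) (x : ℝ) : ℝ :=
  g (u 0) + ∑ k ∈ Finset.range N,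
    (g (u (k+1)) - g (u k)) * (Set.Ioi (u (k+1))).indicator (fun _ => (1:ℝ)) x

lemma alexStep_eq (g : ℝ → ℝ) (u : ℕ → ℝ) (hu : Monotone u) (N j : ℕ) (hj : j < N) (x : ℝ)
    (h1 : u j < x) (h2 : x ≤ u (j+1)) : alexStep g u N x = g (u j) := by
  unfold alexStep
  have : ∑ k ∈ Finset.range N,
    (g (u (k+1)) - g (u k)) * (Set.Ioi (u (k+1))).indicator (fun _ => (1:ℝ)) x
     = ∑ k ∈ Finset.range j, (g (u (k+1)) - g (u k)) := by
    symm
    refine Finset.sum_subset_zero_on_sdiff (Finset.range_subset_range.2 hj.le) ?_ ?_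
    · intro k hk
      simp only [Finset.mem_sdiff, Finset.mem_range, not_lt] at hk
      have : u (j+1) ≤ u (k+1) := hu (by omega)
      rw [Set.indicator_of_notMem (by simp; linarith), mul_zero]
    · intro k hk
      have : u (k+1) ≤ u j := hu (by simpa using hk)
      rw [Set.indicator_of_mem (by simp; linarith), mul_one]
  rw [this, Finset.sum_range_sub (fun k => g (u k))]
  ring

lemma alexStep_abs_le (g : ℝ → ℝ) (hg : BoundedVariationOn g Set.univ) (u : ℕ → ℝ)
    (hu : Monotone u) (N : ℕ) (x : ℝ) :
    |alexStep g u N x| ≤ |g 0| + 2 * (eVariationOn g Set.univ).toReal := by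
  have h0 : |g (u 0) - g 0| ≤ (eVariationOn g Set.univ).toReal := by
    rw [← Real.dist_eq]; exact hg.dist_le (Set.mem_univ _) (Set.mem_univ _)
  have h1 := alex_sum_le g hg u hu N
  have h2 : |∑ k ∈ Finset.range N,
    (g (u (k+1)) - g (u k)) * (Set.Ioi (u (k+1))).indicator (fun _ => (1:ℝ)) x| ≤
      ∑ k ∈ Finset.range N, |g (u (k+1)) - g (u k)| := by
    refine (Finset.abs_sum_le_sum_abs _ _).trans (Finset.sum_le_sum fun k _ => ?_)
    rw [abs_mul]
    refine mul_le_of_le_one_right (abs_nonneg _) ?_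
    unfold Set.indicator
    split_ifs <;> simp
  have h3 : |g (u 0)| ≤ |g 0| + |g (u 0) - g 0| := by
    have := abs_add_le (g 0) (g (u 0) - g 0)
    simpa using this
  unfold alexStep
  refine (abs_add_le _ _).trans ?_
  linarith

lemma alexStep_meas (g : ℝ → ℝ) (u : ℕ → ℝ) (N : ℕ) : Measurable (alexStep g u N) := by
  unfold alexStep
  refine measurable_const.add (Finset.measurable_fun_sum _ fun k _ => ?_)
  exact measurable_const.mul (measurable_const.indicator measurableSet_Ioi)

lemma alexStep_int (f g : ℝ → ℝ) (hf : Integrable f) (u : ℕ → ℝ) (N : ℕ) :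
    ∫ x, f x * alexStep g u N x = g (u 0) * (∫ x, f x) +
      ∑ k ∈ Finset.range N, (g (u (k+1)) - g (u k)) * ∫ x in Set.Ioi (u (k+1)), f x := by
  have e : (fun x => f x * alexStep g u N x) = fun x => g (u 0) * f x +
      ∑ k ∈ Finset.range N, (g (u (k+1)) - g (u k)) * (Set.Ioi (u (k+1))).indicator f x := by
    funext x
    unfold alexStep
    rw [mul_add, Finset.mul_sum, mul_comm]
    congr 1
    refine Finset.sum_congr rfl fun k _ => ?_
    unfold Set.indicator
    split_ifs <;> ring
  have hi : ∀ k ∈ Finset.range N, Integrable (fun x =>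
      (g (u (k+1)) - g (u k)) * (Set.Ioi (u (k+1))).indicator f x) :=
    fun k _ => (hf.indicator measurableSet_Ioi).const_mul _
  rw [e, integral_add (hf.const_mul _) (integrable_finsetSum _ hi), integral_const_mul,
    integral_finsetSum _ hi]
  congr 1
  refine Finset.sum_congr rfl fun k _ => ?_
  rw [integral_const_mul, integral_indicator measurableSet_Ioi]

lemma alexStep_bound (f g : ℝ → ℝ) (hf : Integrable f) (hg : BoundedVariationOn g Set.univ)
    (u : ℕ → ℝ) (hu : Monotone u) (N m : ℕ) (hm : m ≤ N) :
    |∫ x, f x * alexStep g u N x| ≤ |∫ x, f x| * |g (u m)| +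
      alexNorm f * (eVariationOn g Set.univ).toReal := by
  have hA : 0 ≤ alexNorm f := (abs_nonneg _).trans (alex_univ f hf)
  have key : ∫ x, f x * alexStep g u N x = (∫ x, f x) * g (u m) +
      ∑ k ∈ Finset.range N, (g (u (k+1)) - g (u k)) *
        ((∫ x in Set.Ioi (u (k+1)), f x) - if k < m then ∫ x, f x else 0) := by
    rw [alexStep_int f g hf]
    simp only [mul_sub, Finset.sum_sub_distrib]
    have : ∑ k ∈ Finset.range N, (g (u (k+1)) - g (u k)) * (if k < m then ∫ x, f x else 0)
        = ∑ k ∈ Finset.range m, (g (u (k+1)) - g (u k)) * ∫ x, f x := by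
      symm
      refine Finset.sum_subset_zero_on_sdiff (Finset.range_subset_range.2 hm) ?_ ?_
      · intro k hk
        simp only [Finset.mem_sdiff, Finset.mem_range, not_lt] at hk
        rw [if_neg (by omega), mul_zero]
      · intro k hk
        rw [if_pos (by simpa using hk)]
    rw [this, ← Finset.sum_mul, Finset.sum_range_sub (fun k => g (u k))]
    ring
  rw [key]
  refine (abs_add_le _ _).trans ?_
  rw [abs_mul]
  refine add_le_add_right ?_ _
  calc _ ≤ ∑ k ∈ Finset.range N, |g (u (k+1)) - g (u k)| * alexNorm f := by
        refine (Finset.abs_sum_le_sum_abs _ _).trans (Finset.sum_le_sum fun k _ => ?_)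
        rw [abs_mul]
        refine mul_le_mul_of_nonneg_left ?_ (abs_nonneg _)
        split_ifs
        · have h := integral_add_compl (measurableSet_Ioi (a := u (k+1))) hf
          rw [Set.compl_Ioi] at h
          rw [← h, sub_add_cancel_left, abs_neg]
          exact alex_Iic f hf _
        · rw [sub_zero]; exact alex_Ioi f hf _
    _ ≤ _ := by
        rw [← Finset.sum_mul, mul_comm]
        exact mul_le_mul_of_nonneg_left (alex_sum_le g hg u hu N) hA

lemma alex_main (f g : ℝ → ℝ) (hf : Integrable f) (hg : BoundedVariationOn g Set.univ) (c : ℝ) :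
    |∫ x, f x * g x| ≤ |∫ x, f x| * |g c| + alexNorm f * (eVariationOn g Set.univ).toReal := by
  set u : ℕ → ℕ → ℝ := fun n k => c + ((k:ℝ) / n - n) with hu_def
  have hu : ∀ n, Monotone (u n) := by
    intro n a b hab
    simp only [hu_def]
    have : (a:ℝ) ≤ b := by exact_mod_cast hab
    gcongr
  have hlim : Tendsto (fun n => ∫ x, f x * alexStep g (u n) (2*n*n) x) atTop
      (nhds (∫ x, f x * g x)) := by
    refine tendsto_integral_of_dominated_convergence
      (fun x => ‖f x‖ * (|g 0| + 2 * (eVariationOn g Set.univ).toReal)) ?_ ?_ ?_ ?_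
    · intro n
      exact hf.1.mul (alexStep_meas g _ _).aestronglyMeasurable
    · exact hf.norm.mul_const _
    · intro n
      refine Eventually.of_forall fun x => ?_
      rw [norm_mul]
      exact mul_le_mul_of_nonneg_left (alexStep_abs_le g hg _ (hu n) _ x) (norm_nonneg _)
    · have hd := hg.locallyBoundedVariationOn.ae_differentiableAt
      filter_upwards [hd] with x hx
      refine Tendsto.const_mul _ ?_
      -- choose grid index
      set j : ℕ → ℕ := fun n => ⌈(x - c + n) * n⌉₊ - 1 with hj
      have hev : ∀ᶠ n : ℕ in atTop, j n < 2*n*n ∧ u n (j n) < x ∧ x ≤ u n (j n + 1) ∧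
          x - 1 / (n:ℝ) ≤ u n (j n) := by
        obtain ⟨M, hM⟩ := exists_nat_gt |x - c|
        filter_upwards [eventually_ge_atTop M, eventually_gt_atTop 0] with n hn hn0
        have hnM : |x - c| < n := hM.trans_le (by exact_mod_cast hn)
        have hn0' : (0:ℝ) < n := by exact_mod_cast hn0
        obtain ⟨hl, hr⟩ := abs_lt.1 hnM
        have hpos : 0 < (x - c + n) * n := by apply mul_pos <;> linarith
        have hc1 := Nat.ceil_pos.2 hpos
        have hj1 : j n + 1 = ⌈(x - c + n) * n⌉₊ := by simp only [hj]; omega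
        have ha : (x - c + n) * n ≤ (j n : ℝ) + 1 := by
          have := Nat.le_ceil ((x - c + n) * n)
          rw [← hj1] at this; exact_mod_cast this
        have hb : (j n : ℝ) < (x - c + n) * n := by
          have := Nat.ceil_lt_add_one hpos.le
          rw [← hj1] at this; push_cast at this; linarith
        have hb' : (j n : ℝ) / n < x - c + n := (div_lt_iff₀ hn0').2 hb
        have ha' : x - c + n ≤ ((j n : ℝ) + 1) / n := (le_div_iff₀ hn0').2 ha
        refine ⟨?_, ?_, ?_, ?_⟩
        · have : (j n : ℝ) < 2 * n * n := by nlinarith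
          exact_mod_cast this
        · simp only [hu_def]; linarith
        · simp only [hu_def]; push_cast; linarith
        · simp only [hu_def]; rw [add_div] at ha'; linarith
      have hut : Tendsto (fun n => u n (j n)) atTop (nhds x) := by
        have h1 : Tendsto (fun n : ℕ => x - 1 / (n:ℝ)) atTop (nhds x) := by
          simpa using (tendsto_const_nhds (x := x)).sub tendsto_one_div_atTop_nhds_zero_nat
        refine tendsto_of_tendsto_of_tendsto_of_le_of_le' h1 tendsto_const_nhds ?_ ?_
        · filter_upwards [hev] with n hn using hn.2.2.2
        · filter_upwards [hev] with n hn using hn.2.1.le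
      refine (hx.continuousAt.tendsto.comp hut).congr' ?_
      filter_upwards [hev] with n hn
      exact (alexStep_eq g (u n) (hu n) _ _ hn.1 x hn.2.1 hn.2.2.1).symm
  refine le_of_tendsto hlim.abs ?_
  filter_upwards [eventually_gt_atTop 0] with n hn
  have h := alexStep_bound f g hf hg (u n) (hu n) (2*n*n) (n*n) (by nlinarith)
  have hc : u n (n*n) = c := by
    have : (n:ℝ) ≠ 0 := by positivity
    simp only [hu_def]; push_cast; field_simp; ring
  rwa [hc] at h

/-- Hölder inequality for the Alexiewicz norm: for `f` Lebesgue integrable and `g` of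
bounded variation with limit `gm` at `-∞`,
`|∫ fg| ≤ |∫ f| ⬝ inf |g| + ‖f‖_A ⬝ Vg ≤ ‖f‖_A (|g(-∞)| + Vg)`. -/
theorem holder_inequality_alexiewicz
    (f g : ℝ → ℝ) (hf : Integrable f)
    (hg : BoundedVariationOn g Set.univ)
    (gm : ℝ) (hgm : Tendsto g atBot (nhds gm)) :
    |∫ x, f x * g x| ≤
        |∫ x, f x| * (⨅ x : ℝ, |g x|) +
          alexNorm f * (eVariationOn g Set.univ).toReal ∧
    |∫ x, f x * g x| ≤ alexNorm f * (|gm| + (eVariationOn g Set.univ).toReal) := by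
  constructor
  · rw [Real.mul_iInf_of_nonneg (abs_nonneg _), ← sub_le_iff_le_add]
    refine le_ciInf fun c => ?_
    have := alex_main f g hf hg c
    linarith
  · have h : Tendsto (fun c => |∫ x, f x| * |g c| +
        alexNorm f * (eVariationOn g Set.univ).toReal) atBot (nhds (|∫ x, f x| * |gm| +
        alexNorm f * (eVariationOn g Set.univ).toReal)) :=
      (hgm.abs.const_mul _).add_const _
    have h2 := ge_of_tendsto' h (alex_main f g hf hg)
    have h3 := mul_le_mul_of_nonneg_right (alex_univ f hf) (abs_nonneg gm)
    rw [mul_add]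
    linarith
end

section
/- Let f : ℝ → ℝ be Lebesgue integrable with support contained in a compact interval [A,B]. Let g : ℝ × ℝ → ℝ be measurable such that: (i) for each x ∈ ℝ the function y ↦ g(x,y) is of bounded variation on ℝ; (ii) the function x ↦ V_{y∈ℝ} g(x,y) is Lebesgue integrable; (iv) for each y ∈ [A,B] the function x ↦ g(x,y) is Lebesgue integrable. Then both iterated integrals exist and ∫_ℝ ( ∫_ℝ f(y) g(x,y) dy ) dx = ∫_ℝ ( ∫_ℝ f(y) g(x,y) dx ) dy. -/
open MeasureTheory Filter

/-- Fubini-type theorem: let `f` be Lebesgue integrable with support in a compact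
interval `[A, B]`, and let `g : ℝ × ℝ → ℝ` be measurable with (i) each section
`y ↦ g(x,y)` of bounded variation, (ii) `x ↦ V_y g(x,y)` integrable, and (iv) for each
`y ∈ [A,B]` the section `x ↦ g(x,y)` integrable.  Then both iterated integrals of
`f(y) g(x,y)` exist and are equal. -/
theorem fubini_compact_support
    (A B : ℝ) (f : ℝ → ℝ) (hf : Integrable f)
    (hsupp : Function.support f ⊆ Set.Icc A B)
    (g : ℝ × ℝ → ℝ) (hmeas : Measurable g)
    (hbv : ∀ x : ℝ, BoundedVariationOn (fun y => g (x, y)) Set.univ)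
    (hvint : Integrable (fun x => (eVariationOn (fun y => g (x, y)) Set.univ).toReal))
    (hsec : ∀ y ∈ Set.Icc A B, Integrable (fun x => g (x, y))) :
    (∀ x : ℝ, Integrable (fun y => f y * g (x, y))) ∧
    Integrable (fun x => ∫ y, f y * g (x, y)) ∧
    (∀ y : ℝ, Integrable (fun x => f y * g (x, y))) ∧
    Integrable (fun y => ∫ x, f y * g (x, y)) ∧
    ∫ x, (∫ y, f y * g (x, y)) = ∫ y, (∫ x, f y * g (x, y)) := by
  by_cases hAB : A ≤ B
  swap
  · have h0 : f = 0 := by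
      rw [← Function.support_eq_empty_iff]
      rw [Set.Icc_eq_empty hAB] at hsupp
      exact Set.subset_empty_iff.mp hsupp
    subst h0
    simp
  have hA : A ∈ Set.Icc A B := ⟨le_refl _, hAB⟩
  have hbound : ∀ x y, |g (x, y)| ≤
      |g (x, A)| + (eVariationOn (fun y => g (x, y)) Set.univ).toReal := by
    intro x y
    have h1 := (hbv x).dist_le (Set.mem_univ y) (Set.mem_univ A)
    rw [Real.dist_eq] at h1
    have h2 := abs_sub_abs_le_abs_sub (g (x, y)) (g (x, A))
    linarith
  have hh : Integrable (fun x => |g (x, A)| +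
      (eVariationOn (fun y => g (x, y)) Set.univ).toReal) := (hsec A hA).abs.add hvint
  have hprod : Integrable (fun p : ℝ × ℝ => f p.2 * g p)
      ((volume : Measure ℝ).prod (volume : Measure ℝ)) := by
    refine (hh.mul_prod hf).mono ?_ ?_
    · exact hf.aestronglyMeasurable.comp_snd.mul hmeas.aestronglyMeasurable
    · refine Eventually.of_forall fun p => ?_
      obtain ⟨x, y⟩ := p
      simp only [norm_mul, Real.norm_eq_abs]
      rw [mul_comm]
      exact mul_le_mul_of_nonneg_right ((hbound x y).trans (le_abs_self _)) (abs_nonneg _)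
  refine ⟨fun x => ?_, hprod.integral_prod_left, fun y => ?_, hprod.integral_prod_right,
    integral_integral_swap hprod⟩
  · refine hf.mul_bdd (c := |g (x, A)| + (eVariationOn (fun y => g (x, y)) Set.univ).toReal) ?_ ?_
    · exact (hmeas.comp measurable_prodMk_left).aestronglyMeasurable
    · exact Eventually.of_forall fun y => hbound x y
  · by_cases hy : y ∈ Set.Icc A B
    · exact (hsec y hy).const_mul _
    · have : f y = 0 := by
        by_contra h
        exact hy (hsupp h)
      simp [this]
end

section
/- Let f, g : ℝ → ℝ be Lebesgue integrable with primitives F(y) = ∫_{−∞}^y f(t) dt and G(x) = ∫_{−∞}^x g(t) dt. Then for every smooth compactly supported φ : ℝ → ℝ, ∫_ℝ ∫_ℝ f(y) g(x) φ(x+y) dx dy = ∫_ℝ ∫_ℝ F(y) G(x) φ″(x+y) dx dy. -/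
open MeasureTheory Filter

lemma aux_cont (f F : ℝ → ℝ) (hf : Integrable f)
    (hF : ∀ y : ℝ, F y = ∫ t in Set.Iic y, f t) : Continuous F := by
  have : F = fun y => (∫ t in Set.Iic (0:ℝ), f t) + ∫ t in (0:ℝ)..y, f t := by
    funext y
    rw [hF, ← intervalIntegral.integral_Iic_sub_Iic hf.integrableOn hf.integrableOn]
    ring
  rw [this]
  exact continuous_const.add
    (intervalIntegral.continuous_primitive (fun a b => hf.intervalIntegrable) 0)

lemma aux_bdd_s16 (f F : ℝ → ℝ) (hf : Integrable f)
    (hF : ∀ y : ℝ, F y = ∫ t in Set.Iic y, f t) (y : ℝ) : ‖F y‖ ≤ ∫ t, ‖f t‖ := by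
  rw [hF]
  exact (norm_integral_le_integral_norm _).trans
    (setIntegral_le_integral hf.norm (Eventually.of_forall fun _ => norm_nonneg _))

lemma aux_parts_s16 (f F : ℝ → ℝ) (hf : Integrable f)
    (hF : ∀ y : ℝ, F y = ∫ t in Set.Iic y, f t) (ψ : ℝ → ℝ) (hψ : ContDiff ℝ 1 ψ)
    (hc : HasCompactSupport ψ) :
    ∫ y, F y * deriv ψ y = - ∫ y, f y * ψ y := by
  have hd : Integrable (deriv ψ) :=
    (hψ.continuous_deriv le_rfl).integrable_of_hasCompactSupport hc.deriv
  have hprod : Integrable (fun p : ℝ × ℝ => f p.1 * deriv ψ p.2) (volume.prod volume) :=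
    hf.mul_prod hd
  have hS : MeasurableSet {p : ℝ × ℝ | p.1 ≤ p.2} := measurableSet_le measurable_fst measurable_snd
  have hind := hprod.indicator hS
  have h := integral_integral_swap (f := fun t y => Set.indicator {p : ℝ × ℝ | p.1 ≤ p.2}
    (fun p : ℝ × ℝ => f p.1 * deriv ψ p.2) (t, y)) hind
  have h1 : ∀ y, ∫ t, Set.indicator {p : ℝ × ℝ | p.1 ≤ p.2}
      (fun p : ℝ × ℝ => f p.1 * deriv ψ p.2) (t, y) = F y * deriv ψ y := by
    intro y
    rw [hF, ← integral_mul_const, ← integral_indicator measurableSet_Iic]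
    rfl
  have h2 : ∀ t, ∫ y, Set.indicator {p : ℝ × ℝ | p.1 ≤ p.2}
      (fun p : ℝ × ℝ => f p.1 * deriv ψ p.2) (t, y) = - (f t * ψ t) := by
    intro t
    have : ∫ y in Set.Ici t, f t * deriv ψ y = -(f t * ψ t) := by
      rw [integral_const_mul, integral_Ici_eq_integral_Ioi, hc.integral_Ioi_deriv_eq hψ]
      ring
    rw [← this, ← integral_indicator measurableSet_Ici]
    rfl
  simp_rw [h1, h2] at h
  rw [← h, integral_neg]

lemma aux_shift (f F : ℝ → ℝ) (hf : Integrable f)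
    (hF : ∀ y : ℝ, F y = ∫ t in Set.Iic y, f t) (ψ : ℝ → ℝ) (hψ : ContDiff ℝ 1 ψ)
    (hc : HasCompactSupport ψ) (c : ℝ) :
    ∫ y, F y * deriv ψ (y + c) = - ∫ y, f y * ψ (y + c) := by
  have := aux_parts_s16 f F hf hF (fun y => ψ (y + c)) (hψ.comp (contDiff_id.add contDiff_const))
    (hc.comp_homeomorph (Homeomorph.addRight c))
  simpa only [deriv_comp_add_const] using this

lemma aux_int (g ψ : ℝ → ℝ) (hg : Integrable g) (hψ : Integrable ψ) :
    Integrable (fun p : ℝ × ℝ => g p.1 * ψ (p.1 + p.2)) (volume.prod volume) :=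
  (measurePreserving_prod_add (volume : Measure ℝ) (volume : Measure ℝ)).integrable_comp_of_integrable
    (hg.mul_prod hψ)

/-- For `f, g` Lebesgue integrable with primitives `F(y) = ∫_{-∞}^y f` and
`G(x) = ∫_{-∞}^x g`, and every test function `φ`,
`∫∫ f(y) g(x) φ(x+y) dx dy = ∫∫ F(y) G(x) φ''(x+y) dx dy`. -/
theorem convolution_pairing_via_primitives
    (f g : ℝ → ℝ) (hf : Integrable f) (hg : Integrable g)
    (F G : ℝ → ℝ)
    (hF : ∀ y : ℝ, F y = ∫ t in Set.Iic y, f t)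
    (hG : ∀ x : ℝ, G x = ∫ t in Set.Iic x, g t) :
    ∀ φ : ℝ → ℝ, ContDiff ℝ (⊤ : ℕ∞) φ → HasCompactSupport φ →
      ∫ y, (∫ x, f y * g x * φ (x + y)) =
        ∫ y, (∫ x, F y * G x * deriv (deriv φ) (x + y)) := by
  intro φ hφ hc
  have hφ1 : ContDiff ℝ 1 φ := hφ.of_le (by exact_mod_cast le_top)
  have hφ2 : ContDiff ℝ 2 φ := by exact_mod_cast contDiff_infty.1 hφ 2
  have hd1 : ContDiff ℝ 1 (deriv φ) := by
    have : ContDiff ℝ (1 + 1) φ := by simpa [one_add_one_eq_two] using hφ2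
    exact (contDiff_succ_iff_deriv.1 this).2.2
  have hdi : Integrable (deriv φ) := hd1.continuous.integrable_of_hasCompactSupport hc.deriv
  have hR : ∀ y, ∫ x, F y * G x * deriv (deriv φ) (x + y)
      = ∫ x, -(F y * (g x * deriv φ (x + y))) := by
    intro y
    simp_rw [mul_assoc]
    rw [integral_const_mul, aux_shift g G hg hG _ hd1 hc.deriv, integral_neg, integral_const_mul]
    ring
  have hI1 : Integrable (fun p : ℝ × ℝ => -(F p.2 * (g p.1 * deriv φ (p.1 + p.2))))
      (volume.prod volume) :=
    ((aux_int g _ hg hdi).bdd_mul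
      ((aux_cont f F hf hF).comp continuous_snd).aestronglyMeasurable
      (Eventually.of_forall fun p => aux_bdd_s16 f F hf hF p.2)).neg
  have hI2 : Integrable (fun p : ℝ × ℝ => f p.2 * g p.1 * φ (p.1 + p.2))
      (volume.prod volume) := by
    obtain ⟨C, hC⟩ := hc.exists_bound_of_continuous hφ.continuous
    have := (hg.mul_prod hf).bdd_mul (f := fun p : ℝ × ℝ => φ (p.1 + p.2)) (c := C)
      (hφ.continuous.comp (continuous_fst.add continuous_snd)).aestronglyMeasurable
      (Eventually.of_forall fun p => hC _)
    refine this.congr (Eventually.of_forall fun p => ?_)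
    simp only
    ring
  simp_rw [hR]
  rw [← integral_integral_swap (f := fun x y => -(F y * (g x * deriv φ (x + y)))) hI1,
    ← integral_integral_swap (f := fun x y => f y * g x * φ (x + y)) hI2]
  congr 1
  funext x
  have e1 : ∀ y, -(F y * (g x * deriv φ (x + y))) = -g x * (F y * deriv φ (y + x)) := by
    intro y; rw [add_comm x y]; ring
  have e2 : ∀ y, f y * g x * φ (x + y) = g x * (f y * φ (y + x)) := by
    intro y; rw [add_comm x y]; ring
  simp_rw [e1, e2]
  rw [integral_const_mul, integral_const_mul, aux_shift f F hf hF φ hφ1 hc]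
  ring
end
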